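/- arXiv:2211.10158 — 3 statements merged into one kernel-verified Lean document; each statement's English description precedes it below -/
import Mathlib

section
/- For every natural number n and every real number ε with 0 < ε < 1, widim_ε([0,1]^n, ‖·‖_∞) = n; that is, n is the minimal dimension of a finite simplicial complex P for which there exists a continuous map f : [0,1]^n → P such that every fiber f^{-1}(p) has ℓ^∞-diameter < ε. -/
open Filter Topology
open scoped ENNReal NNReal

noncomputable section

/-- Diameter (in `ℝ≥0∞`) of a set with respect to a distance function `ρ`. -/
def setEDiam {X : Type*} (ρ : X → X → ℝ) (E : Set X) : ℝ≥0∞ :=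
  ⨆ x ∈ E, ⨆ y ∈ E, ENNReal.ofReal (ρ x y)

/-- Openness with respect to a distance function `ρ`. -/
def ROpen {X : Type*} (ρ : X → X → ℝ) (U : Set X) : Prop :=
  ∀ x ∈ U, ∃ δ > 0, ∀ y, ρ x y < δ → y ∈ U

/-- `#(E, ρ, ε)`: the minimal number `n` of `ρ`-open sets of `ρ`-diameter `< ε` covering `E`
(`0` when `E = ∅`, since the empty family covers it). -/
def covNum {X : Type*} (ρ : X → X → ℝ) (ε : ℝ) (E : Set X) : ℕ :=
  sInf {n : ℕ | ∃ U : Fin n → Set X, (∀ i, ROpen ρ (U i)) ∧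
    (∀ i, setEDiam ρ (U i) < ENNReal.ofReal ε) ∧ E ⊆ ⋃ i, U i}

/-- The dynamical metric `d_N(x,y) = max_{0 ≤ n < N} d(Tⁿx, Tⁿy)`. -/
def dynDist {X : Type*} (T : X → X) (d : X → X → ℝ) (N : ℕ) (x y : X) : ℝ :=
  sSup {r : ℝ | ∃ n, n < N ∧ r = d (T^[n] x) (T^[n] y)}

/-- `sup_{y ∈ Y} log #(π⁻¹(y), ρ, ε)`. -/
def supLogCov {X Y : Type*} (π : X → Y) (ρ : X → X → ℝ) (ε : ℝ) : ℝ :=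
  ⨆ y : Y, Real.log (covNum ρ ε (π ⁻¹' {y}) : ℝ)

/-- `sup_{y ∈ Y} log #(π⁻¹(B_δ(y, ρY)), ρX, ε)` where `B_δ` is the closed `δ`-ball. -/
def supLogCovBall {X Y : Type*} (π : X → Y) (ρX : X → X → ℝ) (ρY : Y → Y → ℝ)
    (ε δ : ℝ) : ℝ :=
  ⨆ y : Y, Real.log (covNum ρX ε (π ⁻¹' {x | ρY x y ≤ δ}) : ℝ)

/-- Topological conditional entropy
`h_top(π, T) = lim_{ε→0} lim_{N→∞} (sup_y log #(π⁻¹(y), d_N, ε))/N`, as an extended real. -/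
def condEntropy {X Y : Type*} (π : X → Y) (T : X → X) (d : X → X → ℝ) : EReal :=
  Filter.limsup (fun ε : ℝ => Filter.liminf
      (fun N : ℕ => ((supLogCov π (dynDist T d N) ε / N : ℝ) : EReal)) Filter.atTop)
    (𝓝[>] (0 : ℝ))

/-- `lim_{N→∞} (sup_y log #(π⁻¹(y), d_N, ε))/(N log(1/ε))` (the limit exists by
subadditivity; it is realized here as a liminf). -/
def condMdimRate {X Y : Type*} (π : X → Y) (T : X → X) (d : X → X → ℝ) (ε : ℝ) : EReal :=
  Filter.liminf (fun N : ℕ =>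
    ((supLogCov π (dynDist T d N) ε / (N * Real.log (1 / ε)) : ℝ) : EReal)) Filter.atTop

/-- Lower conditional metric mean dimension of `π : (X,T,d) → Y`. -/
def lowerCondMdimM {X Y : Type*} (π : X → Y) (T : X → X) (d : X → X → ℝ) : EReal :=
  Filter.liminf (fun ε : ℝ => condMdimRate π T d ε) (𝓝[>] (0 : ℝ))

/-- Upper conditional metric mean dimension of `π : (X,T,d) → Y`. -/
def upperCondMdimM {X Y : Type*} (π : X → Y) (T : X → X) (d : X → X → ℝ) : EReal :=
  Filter.limsup (fun ε : ℝ => condMdimRate π T d ε) (𝓝[>] (0 : ℝ))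

/-- `lim_{N→∞} log #(X, d_N, ε)/(N log(1/ε))`. -/
def mdimMRate {X : Type*} (T : X → X) (d : X → X → ℝ) (ε : ℝ) : EReal :=
  Filter.liminf (fun N : ℕ =>
    ((Real.log (covNum (dynDist T d N) ε (Set.univ : Set X) : ℝ) /
      (N * Real.log (1 / ε)) : ℝ) : EReal)) Filter.atTop

/-- Lower metric mean dimension of `(X, T, d)`. -/
def lowerMdimM {X : Type*} (T : X → X) (d : X → X → ℝ) : EReal :=
  Filter.liminf (fun ε : ℝ => mdimMRate T d ε) (𝓝[>] (0 : ℝ))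

/-- Upper metric mean dimension of `(X, T, d)`. -/
def upperMdimM {X : Type*} (T : X → X) (d : X → X → ℝ) : EReal :=
  Filter.limsup (fun ε : ℝ => mdimMRate T d ε) (𝓝[>] (0 : ℝ))

/-- `widim_ε(X, ρ)`: the minimal `k` such that there are a finite simplicial complex of
dimension `≤ k` (realized in some `ℝ^m`) and a continuous `ε`-embedding `f : X → P`
(all fibers of `f` have `ρ`-diameter `< ε`). -/
def widim (X : Type*) [TopologicalSpace X] (ρ : X → X → ℝ) (ε : ℝ) : ℕ :=
  sInf {k : ℕ | ∃ (m : ℕ) (K : Geometry.SimplicialComplex ℝ (Fin m → ℝ)),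
    K.faces.Finite ∧ (∀ s ∈ K.faces, s.card ≤ k + 1) ∧
    ∃ f : X → K.space, Continuous f ∧
      ∀ p : K.space, setEDiam ρ (f ⁻¹' {p}) < ENNReal.ofReal ε}

/-- Mean dimension `mdim(X, T) = lim_{ε→0} lim_{N→∞} widim_ε(X, d_N)/N`. -/
def mdim (X : Type*) [TopologicalSpace X] (T : X → X) (d : X → X → ℝ) : EReal :=
  Filter.limsup (fun ε : ℝ => Filter.liminf
      (fun N : ℕ => (((widim X (dynDist T d N) ε : ℝ) / N : ℝ) : EReal)) Filter.atTop)
    (𝓝[>] (0 : ℝ))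

/-- The cube `[0,1]^a`. -/
abbrev Cube (a : ℕ) := Fin a → unitInterval

/-- The full shift space `([0,1]^a)^ℤ`. -/
abbrev FullShift (a : ℕ) := ℤ → Cube a

/-- The shift map `σ((x_n)_n) = (x_{n+1})_n`. -/
def shift {α : Type*} (x : ℤ → α) : ℤ → α := fun n => x (n + 1)

/-- The `ℓ^∞`-distance on the cube `[0,1]^a`. -/
def cubeDist {a : ℕ} (x y : Cube a) : ℝ :=
  ‖(fun i => (x i : ℝ)) - fun i => (y i : ℝ)‖

/-- The metric `D((x_n), (y_n)) = Σ_{n∈ℤ} 2^{-|n|} ‖x_n − y_n‖_∞` on the full shift. -/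
def shiftDist {a : ℕ} (x y : FullShift a) : ℝ :=
  ∑' n : ℤ, (2 : ℝ) ^ (-|n|) * cubeDist (x n) (y n)

end

theorem det_one_add_smul_pos {E : Type*} [NormedAddCommGroup E] [NormedSpace ℝ E]
    [FiniteDimensional ℝ E] (A : E →L[ℝ] E) {t : ℝ} (ht : 0 ≤ t) (htA : t * ‖A‖ < 1) :
    0 < (ContinuousLinearMap.id ℝ E + t • A).det := by
  have hne : ∀ s ∈ Set.Icc 0 t, (ContinuousLinearMap.id ℝ E + s • A).det ≠ 0 := by
    intro s hs h0
    have hker := LinearMap.bot_lt_ker_of_det_eq_zero h0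
    obtain ⟨v, hv, hv0⟩ := (Submodule.ne_bot_iff _).1 hker.ne'
    have hv' : v + s • A v = 0 := by simpa using hv
    have hpos : 0 < ‖v‖ := norm_pos_iff.2 hv0
    have h1 : ‖v‖ = s * ‖A v‖ := by
      have := congrArg norm (eq_neg_of_add_eq_zero_left hv')
      rwa [norm_neg, norm_smul, Real.norm_of_nonneg hs.1] at this
    have h2 : s * ‖A v‖ ≤ t * (‖A‖ * ‖v‖) := by
      have := A.le_opNorm v
      have := hs.1
      have := hs.2
      gcongr
    nlinarith
  have hcont : Continuous fun s : ℝ => (ContinuousLinearMap.id ℝ E + s • A).det :=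
    ContinuousLinearMap.continuous_det.comp (by fun_prop)
  by_contra hle
  have h0 : (ContinuousLinearMap.id ℝ E + (0 : ℝ) • A).det = 1 := by
    simp [ContinuousLinearMap.det]
  obtain ⟨s, hs, hs0⟩ := intermediate_value_Icc' ht hcont.continuousOn
    (show (0 : ℝ) ∈ Set.Icc _ _ from ⟨not_lt.1 hle, by rw [h0]; exact zero_le_one⟩)
  exact hne s hs hs0

/-- `t ↦ det (1 + t A)` is a polynomial of degree at most `n`. -/
theorem exists_polynomial_det_one_add_smul {n : ℕ} (A : (Fin n → ℝ) →L[ℝ] (Fin n → ℝ)) :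
    ∃ p : Polynomial ℝ, p.natDegree ≤ n ∧
      ∀ t : ℝ, (ContinuousLinearMap.id ℝ (Fin n → ℝ) + t • A).det = p.eval t := by
  let M := LinearMap.toMatrix' (A : (Fin n → ℝ) →ₗ[ℝ] (Fin n → ℝ))
  refine ⟨((Polynomial.X : Polynomial ℝ) • M.map Polynomial.C +
    (1 : Matrix (Fin n) (Fin n) ℝ).map Polynomial.C).det, ?_, fun t => ?_⟩
  · simpa only [Fintype.card_fin] using Polynomial.natDegree_det_X_add_C_le M 1
  · rw [← Polynomial.coe_evalRingHom t, RingHom.map_det, ContinuousLinearMap.det,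
      ← LinearMap.det_toMatrix']
    congr 1
    ext i j
    by_cases hij : i = j <;>
      simp [M, LinearMap.toMatrix'_apply, hij, add_comm, mul_comm t]

/-- A Lipschitz map sends null sets to null sets. -/
theorem LipschitzWith.volume_image_eq_zero {n : ℕ} {f : (Fin n → ℝ) → (Fin n → ℝ)} {C : ℝ≥0}
    (hf : LipschitzWith C f) {s : Set (Fin n → ℝ)} (hs : MeasureTheory.volume s = 0) :
    MeasureTheory.volume (f '' s) = 0 := by
  have h := hf.hausdorffMeasure_image_le (d := (Fintype.card (Fin n) : ℝ)) (by positivity) s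
  rw [MeasureTheory.hausdorffMeasure_pi_real, hs, mul_zero] at h
  exact le_antisymm h zero_le

theorem LipschitzWith.bijective_id_add_smul {E : Type*} [NormedAddCommGroup E] [NormedSpace ℝ E]
    [CompleteSpace E] {g : E → E} {C : ℝ≥0} (hg : LipschitzWith C g) {t : ℝ} (ht : 0 ≤ t)
    (htC : t * C < 1) : Function.Bijective fun x => x + t • g x := by
  have happ : ApproximatesLinearOn (fun x => x + t • g x)
      ((ContinuousLinearEquiv.refl ℝ E : E ≃L[ℝ] E) : E →L[ℝ] E) Set.univ (t.toNNReal * C) := by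
    rw [ApproximatesLinearOn]
    intro x _ y _
    have h : x + t • g x - (y + t • g y) - (x - y) = t • (g x - g y) := by
      rw [smul_sub]; abel
    have h2 := hg.dist_le_mul x y
    rw [dist_eq_norm, dist_eq_norm] at h2
    simp only [ContinuousLinearEquiv.coe_refl, ContinuousLinearMap.coe_id', id, h, norm_smul,
      Real.norm_of_nonneg ht, NNReal.coe_mul, Real.coe_toNNReal _ ht, mul_assoc]
    gcongr
  have hc : Subsingleton E ∨ t.toNNReal * C <
      ‖((ContinuousLinearEquiv.refl ℝ E : E ≃L[ℝ] E).symm : E →L[ℝ] E)‖₊⁻¹ := by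
    rcases subsingleton_or_nontrivial E with h | h
    · exact Or.inl h
    · right
      have : ‖((ContinuousLinearEquiv.refl ℝ E : E ≃L[ℝ] E).symm : E →L[ℝ] E)‖₊ = 1 :=
        NNReal.eq ContinuousLinearMap.norm_id
      rw [this, inv_one, ← NNReal.coe_lt_coe]
      simpa [Real.coe_toNNReal _ ht] using htC
  refine ⟨?_, happ.surjective hc⟩
  have := happ.injOn hc
  exact Set.injOn_univ.1 this

/-- If `‖r‖` is locally constant and nonzero then `Dr` is singular. -/
theorem det_fderiv_eq_zero_of_norm_eventually_eq {E : Type*} [NormedAddCommGroup E]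
    [NormedSpace ℝ E] [FiniteDimensional ℝ E] {r : E → E} {r' : E →L[ℝ] E} {x : E} {R : ℝ}
    (hR : 0 < R) (hr : HasFDerivAt r r' x) (hnorm : ∀ᶠ y in 𝓝 x, ‖r y‖ = R) : r'.det = 0 := by
  by_contra hdet
  have hsurj : Function.Surjective r' := by
    have hu : IsUnit (r' : E →ₗ[ℝ] E) :=
      (LinearMap.isUnit_iff_isUnit_det _).2 (isUnit_iff_ne_zero.2 hdet)
    exact ((Module.End.isUnit_iff _).1 hu).2
  obtain ⟨v, hv⟩ := hsurj (r x)
  have hx : ‖r x‖ = R := hnorm.self_of_nhds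
  have hline : HasDerivAt (fun t : ℝ => x + t • v) v 0 := by
    simpa using ((hasDerivAt_id (0 : ℝ)).smul_const v).const_add x
  have hd : HasDerivAt (fun t : ℝ => r (x + t • v)) (r x) 0 := by
    rw [← hv]
    exact HasFDerivAt.comp_hasDerivAt (0 : ℝ) (by simpa using hr) hline
  have ho := hd.isLittleO
  rw [Asymptotics.isLittleO_iff] at ho
  have h1 := ho (c := R / 2) (by positivity)
  have h2 : ∀ᶠ t : ℝ in 𝓝 0, ‖r (x + t • v)‖ = R := by
    have : Tendsto (fun t : ℝ => x + t • v) (𝓝 0) (𝓝 x) := by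
      simpa using hline.continuousAt.tendsto
    exact this.eventually hnorm
  obtain ⟨t, ⟨ht1, ht2⟩, ht0⟩ := (((h1.and h2).filter_mono
    (nhdsWithin_le_nhds (s := Set.Ioi 0))).and self_mem_nhdsWithin).exists
  have ht0 : 0 < t := ht0
  simp only [sub_zero, zero_smul, add_zero, Real.norm_of_nonneg ht0.le] at ht1
  have h3 : ‖r x + t • r x‖ = (1 + t) * R := by
    rw [show r x + t • r x = (1 + t) • r x by rw [add_smul, one_smul], norm_smul,
      hx, Real.norm_of_nonneg (by positivity)]
  have h4 : ‖r x + t • r x‖ ≤ ‖r (x + t • v) - r x - t • r x‖ + ‖r (x + t • v)‖ := by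
    have := norm_sub_le (r (x + t • v)) (r (x + t • v) - r x - t • r x)
    rw [show r (x + t • v) - (r (x + t • v) - r x - t • r x) = r x + t • r x by abel] at this
    linarith
  nlinarith

open MeasureTheory in
/-- There is no Lipschitz retraction of a ball onto its bounding sphere. -/
theorem not_exists_lipschitz_retraction {n : ℕ} {g : (Fin n → ℝ) → (Fin n → ℝ)} {C : ℝ≥0} {R : ℝ}
    (hR : 0 < R) (hg : LipschitzWith C g) (hout : ∀ x, R ≤ ‖x‖ → g x = 0)
    (hin : ∀ x, ‖x‖ ≤ R → ‖x + g x‖ = R) : False := by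
  let E := Fin n → ℝ
  let B : Set E := Metric.ball 0 R
  let D : Set E := B ∩ {x | DifferentiableAt ℝ g x}
  have hD : MeasurableSet D := Metric.isOpen_ball.measurableSet.inter
    (measurableSet_of_differentiableAt ℝ g)
  have hBD : volume (B \ D) = 0 := by
    refine measure_mono_null (fun x hx => ?_) (ae_iff.1 (hg.ae_differentiableAt (μ := volume)))
    exact fun hd => hx.2 ⟨hx.1, hd⟩
  have hBfin : volume B < ⊤ := measure_ball_lt_top
  have key : ∀ t : ℝ, 0 ≤ t → t * C < 1 →
      IntegrableOn (fun x => (ContinuousLinearMap.id ℝ E + t • fderiv ℝ g x).det) D ∧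
      ∫ x in D, (ContinuousLinearMap.id ℝ E + t • fderiv ℝ g x).det = volume.real B := by
    intro t ht htC
    let φ : E → E := fun x => x + t • g x
    have hbij : Function.Bijective φ := hg.bijective_id_add_smul ht htC
    have hφB : φ '' B = B := by
      have h : φ '' Bᶜ = Bᶜ := by
        refine (Set.image_congr fun x hx => ?_).trans (Set.image_id _)
        simp [φ, hout x (by simpa [B] using hx)]
      rw [Set.image_compl_eq hbij] at h
      exact compl_injective h
    have hφL : LipschitzWith (1 + ‖t‖₊ * C) φ :=
      LipschitzWith.id.add ((lipschitzWith_smul t).comp hg)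
    have hvol : volume (φ '' D) = volume B := by
      refine le_antisymm (measure_mono ((Set.image_mono Set.inter_subset_left).trans hφB.subset)) ?_
      calc volume B = volume (φ '' D ∪ φ '' (B \ D)) := by
            rw [← Set.image_union, Set.union_sdiff_cancel Set.inter_subset_left, hφB]
        _ ≤ volume (φ '' D) + volume (φ '' (B \ D)) := measure_union_le _ _
        _ = volume (φ '' D) := by rw [hφL.volume_image_eq_zero hBD, add_zero]
    have hder : ∀ x ∈ D, HasFDerivWithinAt φ (ContinuousLinearMap.id ℝ E + t • fderiv ℝ g x) D x :=
      fun x hx => ((hasFDerivAt_id x).add (hx.2.hasFDerivAt.const_smul t)).hasFDerivWithinAt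
    have habs : ∀ x, |(ContinuousLinearMap.id ℝ E + t • fderiv ℝ g x).det| • (1 : ℝ) =
        (ContinuousLinearMap.id ℝ E + t • fderiv ℝ g x).det := by
      intro x
      rw [smul_eq_mul, mul_one, abs_of_pos]
      refine det_one_add_smul_pos _ ht (lt_of_le_of_lt ?_ htC)
      have := norm_fderiv_le_of_lipschitz ℝ hg (x₀ := x)
      gcongr
    have h1 := integrableOn_image_iff_integrableOn_abs_det_fderiv_smul volume hD hder
      hbij.injective.injOn (fun _ => (1 : ℝ))
    have h2 := integral_image_eq_integral_abs_det_fderiv_smul volume hD hder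
      hbij.injective.injOn (fun _ => (1 : ℝ))
    simp only [habs] at h1 h2
    refine ⟨h1.1 ?_, ?_⟩
    · rw [integrableOn_const_iff]
      right
      rw [hvol]; exact hBfin
    · rw [← h2]
      simp [Measure.real, hvol]
  have hzero : ∀ x ∈ D, (ContinuousLinearMap.id ℝ E + (1 : ℝ) • fderiv ℝ g x).det = 0 := by
    intro x hx
    rw [one_smul]
    refine det_fderiv_eq_zero_of_norm_eventually_eq (r := fun y => y + g y) hR
      ((hasFDerivAt_id x).add hx.2.hasFDerivAt) ?_
    filter_upwards [Metric.isOpen_ball.mem_nhds hx.1] with y hy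
    exact hin y (by simpa using (Metric.mem_ball.1 hy).le)
  -- Lagrange interpolation through small nodes expresses the value at `1`.
  let v : ℕ → ℝ := fun j => j / ((n + 1) * (C + 1))
  have hv : Function.Injective v := fun i j hij => by
    have h : ((n : ℝ) + 1) * (C + 1) ≠ 0 := by positivity
    have := (div_left_inj' h).1 hij
    exact_mod_cast this
  have hv0 : ∀ j, 0 ≤ v j := fun j => by positivity
  have hvC : ∀ j ∈ Finset.range (n + 1), v j * C < 1 := by
    intro j hj
    have hj' : (j : ℝ) < n + 1 := by exact_mod_cast Finset.mem_range.1 hj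
    have hC : (0 : ℝ) ≤ C := C.2
    simp only [v]
    rw [div_mul_eq_mul_div, div_lt_one (by positivity)]
    nlinarith
  let w : ℕ → ℝ := fun j => (Lagrange.basis (Finset.range (n + 1)) v j).eval 1
  have hw : ∑ j ∈ Finset.range (n + 1), w j = 1 := by
    have := congrArg (Polynomial.eval (1 : ℝ))
      (Lagrange.sum_basis (s := Finset.range (n + 1)) hv.injOn ⟨0, by simp⟩)
    simpa [Polynomial.eval_finsetSum] using this
  have hlag : ∀ A : E →L[ℝ] E, (ContinuousLinearMap.id ℝ E + (1 : ℝ) • A).det =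
      ∑ j ∈ Finset.range (n + 1), w j * (ContinuousLinearMap.id ℝ E + v j • A).det := by
    intro A
    obtain ⟨p, hp, hpA⟩ := exists_polynomial_det_one_add_smul A
    have hdeg : p.degree < ((Finset.range (n + 1)).card : WithBot ℕ) := by
      refine (Polynomial.degree_le_of_natDegree_le hp).trans_lt ?_
      rw [Finset.card_range]; exact_mod_cast Nat.lt_succ_self n
    have := congrArg (Polynomial.eval (1 : ℝ))
      (Lagrange.eq_interpolate (s := Finset.range (n + 1)) hv.injOn hdeg)
    rw [hpA, this, Lagrange.interpolate_apply, Polynomial.eval_finsetSum]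
    refine Finset.sum_congr rfl fun j _ => ?_
    rw [hpA, Polynomial.eval_mul, Polynomial.eval_C, mul_comm]
  have hint : ∫ x in D, (ContinuousLinearMap.id ℝ E + (1 : ℝ) • fderiv ℝ g x).det =
      volume.real B := by
    simp_rw [hlag]
    rw [integral_finsetSum _ fun j hj => ((key (v j) (hv0 j) (hvC j hj)).1.const_mul (w j))]
    rw [Finset.sum_congr rfl fun j hj => by
      rw [integral_const_mul, (key (v j) (hv0 j) (hvC j hj)).2], ← Finset.sum_mul, hw, one_mul]
  rw [setIntegral_congr_fun hD hzero] at hint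
  have hpos : 0 < volume.real B :=
    ENNReal.toReal_pos (Metric.measure_ball_pos volume 0 hR).ne' hBfin.ne
  simp at hint
  exact hpos.ne hint

theorem LipschitzOnWith.exists_smul_of_isCompact {X E : Type*} [PseudoMetricSpace X]
    [NormedAddCommGroup E] [NormedSpace ℝ E] {a : X → ℝ} {b : X → E} {s : Set X} {Ka Kb : ℝ≥0}
    (hs : IsCompact s) (ha : LipschitzOnWith Ka a s) (hb : LipschitzOnWith Kb b s) :
    ∃ K, LipschitzOnWith K (fun x => a x • b x) s := by
  obtain ⟨A, hA⟩ := hs.exists_bound_of_continuousOn ha.continuousOn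
  obtain ⟨B, hB⟩ := hs.exists_bound_of_continuousOn hb.continuousOn
  refine ⟨A.toNNReal * Kb + B.toNNReal * Ka, LipschitzOnWith.of_dist_le_mul fun x hx y hy => ?_⟩
  have hA0 : 0 ≤ A := (norm_nonneg _).trans (hA x hx)
  have hB0 : 0 ≤ B := (norm_nonneg _).trans (hB x hx)
  have h1 := ha.dist_le_mul x hx y hy
  have h2 := hb.dist_le_mul x hx y hy
  rw [dist_eq_norm] at h1 h2
  have h : a x • b x - a y • b y = a x • (b x - b y) + (a x - a y) • b y := by
    rw [smul_sub, sub_smul]; abel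
  rw [dist_eq_norm, h]
  calc ‖a x • (b x - b y) + (a x - a y) • b y‖
      ≤ ‖a x‖ * ‖b x - b y‖ + ‖a x - a y‖ * ‖b y‖ := by
        simpa only [norm_smul] using norm_add_le (a x • (b x - b y)) ((a x - a y) • b y)
    _ ≤ A * (Kb * dist x y) + (Ka * dist x y) * B := by
        have := hA x hx
        have := hB y hy
        gcongr
    _ = _ := by
        push_cast
        rw [Real.coe_toNNReal _ hA0, Real.coe_toNNReal _ hB0]
        ring

theorem LipschitzOnWith.exists_inv {X : Type*} [PseudoMetricSpace X] {a : X → ℝ} {s : Set X}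
    {K : ℝ≥0} {c : ℝ} (hc : 0 < c) (ha : LipschitzOnWith K a s) (hca : ∀ x ∈ s, c ≤ a x) :
    ∃ K', LipschitzOnWith K' (fun x => (a x)⁻¹) s := by
  refine ⟨K * (c⁻¹ * c⁻¹).toNNReal, LipschitzOnWith.of_dist_le_mul fun x hx y hy => ?_⟩
  have h1 := ha.dist_le_mul x hx y hy
  have hx' := hca x hx
  have hy' := hca y hy
  have hx0 := hc.trans_le hx'
  have hy0 := hc.trans_le hy'
  rw [dist_comm, Real.dist_eq] at *
  rw [inv_sub_inv hy0.ne' hx0.ne', abs_div, abs_of_pos (mul_pos hy0 hx0), div_eq_mul_inv, mul_inv]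
  push_cast
  rw [Real.coe_toNNReal _ (by positivity)]
  calc |a x - a y| * ((a y)⁻¹ * (a x)⁻¹) ≤ (K * dist y x) * (c⁻¹ * c⁻¹) := by
        rw [abs_sub_comm]; gcongr; simpa [dist_comm] using h1
    _ = _ := by rw [dist_comm y x]; ring

theorem LipschitzWith.pi {X ι : Type*} [PseudoMetricSpace X] [Fintype ι] {f : X → ι → ℝ} {K : ℝ≥0}
    (h : ∀ i, LipschitzWith K fun x => f x i) : LipschitzWith K f :=
  LipschitzWith.of_dist_le_mul fun x y =>
    (dist_pi_le_iff (by positivity)).2 fun i => (h i).dist_le_mul x y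

/-- Coordinatewise truncation to `[-R, R]`. -/
def truncate {n : ℕ} (R : ℝ) (x : Fin n → ℝ) : Fin n → ℝ := fun i => max (-R) (min R (x i))

theorem lipschitzWith_truncate {n : ℕ} (R : ℝ) : LipschitzWith 1 (truncate (n := n) R) := by
  exact LipschitzWith.pi fun i => ((LipschitzWith.eval i).const_min R).const_max (-R)

theorem truncate_of_norm_le {n : ℕ} {R : ℝ} (hR : 0 ≤ R) {x : Fin n → ℝ} (hx : ‖x‖ ≤ R) :
    truncate R x = x := by
  ext i
  have := abs_le.1 (((pi_norm_le_iff_of_nonneg hR).1 hx) i)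
  rw [truncate, min_eq_right this.2, max_eq_right this.1]

theorem norm_truncate_le {n : ℕ} {R : ℝ} (hR : 0 ≤ R) (x : Fin n → ℝ) : ‖truncate R x‖ ≤ R := by
  refine (pi_norm_le_iff_of_nonneg hR).2 fun i => abs_le.2 ⟨le_max_left _ _, ?_⟩
  exact max_le (by linarith) (min_le_left _ _)

theorem norm_truncate_of_le_norm {n : ℕ} {R : ℝ} (hR : 0 < R) {x : Fin n → ℝ} (hx : R ≤ ‖x‖) :
    ‖truncate R x‖ = R := by
  refine (norm_truncate_le hR.le x).antisymm (not_lt.1 fun h => hx.not_gt ?_)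
  rw [pi_norm_lt_iff hR] at h ⊢
  intro i
  have hi := abs_lt.1 (h i)
  rw [truncate, lt_max_iff, max_lt_iff, min_lt_iff] at hi
  rw [Real.norm_eq_abs, abs_lt]
  rcases hi with ⟨h1 | h1, -, h2 | h2⟩ <;>
    first
    | exact absurd h1 (lt_irrefl _)
    | exact absurd h2 (lt_irrefl _)
    | exact ⟨(lt_min_iff.1 h1).2, h2⟩

theorem exists_eq_zero_of_lipschitzWith {n : ℕ} {L : (Fin n → ℝ) → (Fin n → ℝ)} {K : ℝ≥0}
    (hL : LipschitzWith K L) (hpos : ∀ x i, 1 ≤ x i → 0 < L x i)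
    (hneg : ∀ x i, x i ≤ -1 → L x i < 0) : ∃ x, L x = 0 := by
  by_contra! hne
  let s : (Fin n → ℝ) → ℝ := fun x => max 0 (min 1 (‖x‖ - 1))
  let G : (Fin n → ℝ) → (Fin n → ℝ) := fun x => L x + s x • (x - L x)
  let S : Set (Fin n → ℝ) := Metric.closedBall 0 2
  have hS : IsCompact S := isCompact_closedBall 0 2
  have hs0 : ∀ x, 0 ≤ s x := fun x => le_max_left _ _
  have hs1 : ∀ x, s x ≤ 1 := fun x => max_le zero_le_one (min_le_left _ _)
  have hsL : LipschitzWith 1 s := by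
    have : LipschitzWith 1 fun x : Fin n → ℝ => ‖x‖ - 1 := by
      simpa using lipschitzWith_one_norm.sub (LipschitzWith.const (1 : ℝ))
    exact (this.const_min 1).const_max 0
  have hG0 : ∀ x, G x ≠ 0 := by
    intro x hx
    by_cases h : ‖x‖ < 1
    · have : s x = 0 := max_eq_left ((min_le_right _ _).trans (by linarith))
      simp only [G, this, zero_smul, add_zero] at hx
      exact hne x hx
    · rw [pi_norm_lt_iff one_pos] at h
      push Not at h
      obtain ⟨i, hi⟩ := h
      have hGi : (1 - s x) * L x i + s x * x i = 0 := by
        have := congrFun hx i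
        simp only [G, Pi.add_apply, Pi.smul_apply, Pi.sub_apply, smul_eq_mul, Pi.zero_apply] at this
        linarith
      have h0 := hs0 x
      have h1 := sub_nonneg.2 (hs1 x)
      rcases le_abs.1 hi with hi | hi
      · have := hpos x i hi
        rcases h0.eq_or_lt with h0' | h0'
        · rw [← h0'] at hGi; linarith
        · nlinarith [mul_nonneg h1 this.le]
      · have hi' : x i ≤ -1 := by linarith
        have := hneg x i hi'
        rcases h0.eq_or_lt with h0' | h0'
        · rw [← h0'] at hGi; linarith
        · nlinarith [mul_nonneg h1 (neg_nonneg.2 this.le)]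
  obtain ⟨K₁, hK₁⟩ := LipschitzOnWith.exists_smul_of_isCompact hS hsL.lipschitzOnWith
    (LipschitzWith.id.sub hL).lipschitzOnWith
  have hG : LipschitzOnWith (K + K₁) G S := hL.lipschitzOnWith.add hK₁
  have hGn : LipschitzOnWith (1 * (K + K₁)) (fun x => ‖G x‖) S :=
    lipschitzWith_one_norm.comp_lipschitzOnWith hG
  obtain ⟨x₀, -, hx₀⟩ := hS.exists_isMinOn ⟨0, by simp [S]⟩ hGn.continuousOn
  obtain ⟨K₂, hK₂⟩ := LipschitzOnWith.exists_inv (norm_pos_iff.2 (hG0 x₀)) hGn hx₀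
  obtain ⟨K₃, hK₃⟩ := LipschitzOnWith.exists_smul_of_isCompact hS hK₂ hG
  have hg := (((lipschitzWith_smul (2 : ℝ)).comp_lipschitzOnWith hK₃).sub
    LipschitzWith.id.lipschitzOnWith).comp (lipschitzWith_truncate 2).lipschitzOnWith
    (s := Set.univ) (fun x _ => by simpa [S] using norm_truncate_le zero_le_two x)
  rw [lipschitzOnWith_univ] at hg
  refine not_exists_lipschitz_retraction two_pos hg (fun x hx => ?_) fun x hx => ?_
  · have hy := norm_truncate_of_le_norm two_pos hx
    have hsy : s (truncate 2 x) = 1 := by simp only [s, hy]; norm_num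
    have hGy : G (truncate 2 x) = truncate 2 x := by simp [G, hsy]
    simp [hGy, hy, smul_smul]
  · have h := norm_ne_zero_iff.2 (hG0 x)
    simp [truncate_of_norm_le zero_le_two hx, norm_smul, h]

theorem exists_lipschitzWith_near {X : Type*} [MetricSpace X] [CompactSpace X] (φ : C(X, ℝ))
    {δ : ℝ} (hδ : 0 < δ) : ∃ (ψ : X → ℝ) (K : ℝ≥0), LipschitzWith K ψ ∧ ∀ x, |ψ x - φ x| < δ := by
  let A : Subalgebra ℝ C(X, ℝ) :=
    { carrier := {f | ∃ K : ℝ≥0, LipschitzWith K f}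
      mul_mem' := by
        rintro f g ⟨K, hf⟩ ⟨K', hg⟩
        obtain ⟨K'', h⟩ := LipschitzOnWith.exists_smul_of_isCompact isCompact_univ
          hf.lipschitzOnWith hg.lipschitzOnWith
        exact ⟨K'', lipschitzOnWith_univ.1 h⟩
      add_mem' := by
        rintro f g ⟨K, hf⟩ ⟨K', hg⟩
        exact ⟨K + K', hf.add hg⟩
      algebraMap_mem' := fun r => ⟨0, LipschitzWith.const r⟩ }
  have hA : A.SeparatesPoints := by
    intro x y hxy
    refine ⟨fun z => dist z x,
      ⟨⟨fun z => dist z x, by fun_prop⟩, ⟨1, LipschitzWith.dist_left x⟩, rfl⟩, ?_⟩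
    simpa using (dist_pos.2 hxy.symm).ne
  obtain ⟨⟨ψ, K, hψ⟩, h⟩ :=
    ContinuousMap.exists_mem_subalgebra_near_continuousMap_of_separatesPoints A hA φ δ hδ
  exact ⟨ψ, K, hψ, fun x => ((ψ - φ).norm_coe_le_norm x).trans_lt h⟩

/-- The Poincaré–Miranda theorem on the unit cube. -/
theorem poincare_miranda {n : ℕ} {F : (Fin n → unitInterval) → (Fin n → ℝ)} (hF : Continuous F)
    (hneg : ∀ x i, x i = 0 → F x i ≤ 0) (hpos : ∀ x i, x i = 1 → 0 ≤ F x i) :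
    ∃ x, F x = 0 := by
  by_contra! hne
  obtain ⟨x₀, hx₀⟩ : ∃ x₀, ∀ x, ‖F x₀‖ ≤ ‖F x‖ := by
    obtain ⟨x₀, -, h⟩ := isCompact_univ.exists_isMinOn ⟨0, trivial⟩ hF.norm.continuousOn
    exact ⟨x₀, fun x => h (Set.mem_univ x)⟩
  let δ : ℝ := ‖F x₀‖ / 3
  have hδ : 0 < δ := div_pos (norm_pos_iff.2 (hne x₀)) three_pos
  choose ψ K hψL hψ using fun i : Fin n =>
    exists_lipschitzWith_near ⟨fun x => F x i, by fun_prop⟩ hδ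
  let χ : (Fin n → unitInterval) → (Fin n → ℝ) := fun x i => ψ i x + δ * (2 * x i - 1)
  let q : (Fin n → ℝ) → (Fin n → unitInterval) := fun y i =>
    Set.projIcc 0 1 zero_le_one ((y i + 1) / 2)
  have hq : LipschitzWith 1 q := by
    refine LipschitzWith.of_dist_le_mul fun y z => ?_
    rw [NNReal.coe_one, one_mul]
    refine (dist_pi_le_iff dist_nonneg).2 fun i => ?_
    rw [Subtype.dist_eq, Real.dist_eq]
    refine (Set.abs_projIcc_sub_projIcc _).trans ?_
    have h := dist_le_pi_dist y z i
    rw [Real.dist_eq] at h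
    rw [show (y i + 1) / 2 - (z i + 1) / 2 = (y i - z i) / 2 by ring, abs_div, abs_two]
    linarith [abs_nonneg (y i - z i)]
  have hχ : LipschitzWith (Finset.univ.sup K + ‖2 * δ‖₊) χ := by
    refine LipschitzWith.pi fun i => ?_
    have h1 : LipschitzWith (‖2 * δ‖₊ * 1) fun x : Fin n → unitInterval => (2 * δ) • ((x i : ℝ)) :=
      (lipschitzWith_smul (2 * δ)).comp (LipschitzWith.of_dist_le_mul fun x y => by
        simpa [Subtype.dist_eq] using dist_le_pi_dist x y i)
    have h2 := ((hψL i).weaken (Finset.le_sup (Finset.mem_univ i))).add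
      (h1.sub (LipschitzWith.const δ))
    simp only [mul_one, add_zero] at h2
    have h3 : (fun x => χ x i) = fun x => ψ i x + ((2 * δ) • (x i : ℝ) - δ) := by
      funext x
      simp only [χ, smul_eq_mul]
      ring
    rw [h3]
    exact h2
  obtain ⟨y, hy⟩ := exists_eq_zero_of_lipschitzWith (hχ.comp hq)
    (fun y i hi => by
      have hqi : q y i = 1 := Set.projIcc_of_right_le _ (by linarith)
      have h := abs_lt.1 (hψ i (q y))
      have h' := hpos _ _ hqi
      simp only [ContinuousMap.coe_mk] at h
      simp only [Function.comp, χ, hqi, Set.Icc.coe_one]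
      linarith)
    (fun y i hi => by
      have hqi : q y i = 0 := Set.projIcc_of_le_left _ (by linarith)
      have h := abs_lt.1 (hψ i (q y))
      have h' := hneg _ _ hqi
      simp only [ContinuousMap.coe_mk] at h
      simp only [Function.comp, χ, hqi, Set.Icc.coe_zero]
      linarith)
  have hsmall : ‖F (q y)‖ ≤ 2 * δ := by
    refine (pi_norm_le_iff_of_nonneg (by positivity)).2 fun i => ?_
    have h := abs_lt.1 (hψ i (q y))
    have h0 : ψ i (q y) + δ * (2 * (q y i : ℝ) - 1) = 0 := congrFun hy i
    have h1 := (q y i).2.1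
    have h2 := (q y i).2.2
    simp only [ContinuousMap.coe_mk] at h
    rw [Real.norm_eq_abs, abs_le]
    constructor <;> nlinarith
  have := hx₀ (q y)
  have h3 : ‖F x₀‖ = 3 * δ := by simp only [δ]; ring
  linarith

theorem dimH_convexHull_finset_le {m k : ℕ} {s : Finset (Fin m → ℝ)} (hs : s.card ≤ k + 1) :
    dimH (convexHull ℝ (s : Set (Fin m → ℝ))) ≤ k := by
  rcases s.eq_empty_or_nonempty with rfl | hne
  · simp
  · rw [Real.Convex.dimH_eq_finrank_vectorSpan (convex_convexHull ℝ _)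
      (convexHull_nonempty_iff.2 hne), ← direction_affineSpan, affineSpan_convexHull,
      direction_affineSpan]
    have h := finrank_vectorSpan_image_finset_le ℝ id s
      (show s.card = (s.card - 1) + 1 by have := hne.card_pos; omega)
    rw [Finset.image_id] at h
    exact_mod_cast h.trans (by omega)

theorem dimH_space_le {m k : ℕ} {K : Geometry.SimplicialComplex ℝ (Fin m → ℝ)}
    (hK : K.faces.Finite) (hcard : ∀ s ∈ K.faces, s.card ≤ k + 1) : dimH K.space ≤ k := by
  rw [Geometry.SimplicialComplex.space, dimH_bUnion hK.countable]
  exact iSup₂_le fun s hs => dimH_convexHull_finset_le (hcard s hs)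

theorem ofReal_le_setEDiam {X : Type*} {ρ : X → X → ℝ} {E : Set X} {x y : X} (hx : x ∈ E)
    (hy : y ∈ E) : ENNReal.ofReal (ρ x y) ≤ setEDiam ρ E :=
  le_iSup₂_of_le x hx (le_iSup₂_of_le y hy le_rfl)

theorem one_le_cubeDist {n : ℕ} {x y : Cube n} {i : Fin n} (hx : x i = 0) (hy : y i = 1) :
    1 ≤ cubeDist x y := by
  have h := norm_le_pi_norm ((fun i => (x i : ℝ)) - fun i => (y i : ℝ)) i
  simpa [cubeDist, hx, hy] using h

/-- A continuous map separating opposite faces of the `n`-cube has image of dimension at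
least `n`. -/
theorem le_dimH_of_separates_opposite_faces {n : ℕ} {Y : Type*} [MetricSpace Y] {f : Cube n → Y}
    (hf : Continuous f) (hsep : ∀ x y i, x i = 0 → y i = 1 → f x ≠ f y) {S : Set Y}
    (hS : ∀ x, f x ∈ S) : n ≤ dimH S := by
  by_contra! hlt
  let A : Fin n → Set Y := fun i => f '' {x | x i = 0}
  let B : Fin n → Set Y := fun i => f '' {x | x i = 1}
  have hA : ∀ i, IsCompact (A i) := fun i =>
    (isClosed_eq (continuous_apply i) continuous_const).isCompact.image hf
  have hB : ∀ i, IsCompact (B i) := fun i =>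
    (isClosed_eq (continuous_apply i) continuous_const).isCompact.image hf
  have hAne : ∀ i, (A i).Nonempty := fun i => ⟨f 0, 0, rfl, rfl⟩
  have hBne : ∀ i, (B i).Nonempty := fun i => ⟨f 1, 1, rfl, rfl⟩
  have hAB : ∀ i, Disjoint (A i) (B i) := fun i => by
    rw [Set.disjoint_left]
    rintro _ ⟨x, hx, rfl⟩ ⟨y, hy, hxy⟩
    exact hsep x y i hx hy hxy.symm
  choose r hr hrAB using fun i =>
    Metric.exists_pos_forall_lt_edist (hA i) (hB i).isClosed (hAB i)
  have hrdist : ∀ i, ∀ a ∈ A i, ∀ b ∈ B i, (r i : ℝ) ≤ dist a b := fun i a ha b hb => by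
    have := hrAB i a ha b hb
    rw [edist_nndist, ENNReal.coe_lt_coe] at this
    exact_mod_cast this.le
  have hδ : ∃ δ > 0, ∀ i, δ ≤ (r i : ℝ) := by
    rcases isEmpty_or_nonempty (Fin n) with h | h
    · exact ⟨1, one_pos, fun i => h.elim i⟩
    · obtain ⟨i₀, hi₀⟩ := Finite.exists_min r
      exact ⟨r i₀, hr i₀, fun i => hi₀ i⟩
  obtain ⟨δ, hδ0, hδ⟩ := hδ
  let g : Y → Fin n → ℝ := fun y i => Metric.infDist y (A i) - Metric.infDist y (B i)
  have hg : LipschitzWith (1 + 1) g := LipschitzWith.pi fun i =>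
    (Metric.lipschitz_infDist_pt (A i)).sub (Metric.lipschitz_infDist_pt (B i))
  have hdense : Dense (g '' S)ᶜ := by
    refine dense_compl_of_dimH_lt_finrank ((hg.dimH_image_le S).trans_lt ?_)
    simpa using hlt
  obtain ⟨v, hv, hvδ⟩ := hdense.exists_dist_lt 0 hδ0
  have hvi : ∀ i, |v i| ≤ δ := fun i => by
    rw [dist_zero_left] at hvδ
    exact (norm_le_pi_norm v i).trans hvδ.le
  obtain ⟨x, hx⟩ := poincare_miranda (F := fun x => g (f x) - v)
    ((hg.continuous.comp hf).sub continuous_const)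
    (fun x i hxi => by
      have h1 : f x ∈ A i := ⟨x, hxi, rfl⟩
      have h2 : (r i : ℝ) ≤ Metric.infDist (f x) (B i) :=
        (Metric.le_infDist (hBne i)).2 fun {b} hb => hrdist i _ h1 b hb
      have h3 := abs_le.1 (hvi i)
      have h4 := hδ i
      simp only [g, Pi.sub_apply, Metric.infDist_zero_of_mem h1]
      linarith)
    (fun x i hxi => by
      have h1 : f x ∈ B i := ⟨x, hxi, rfl⟩
      have h2 : (r i : ℝ) ≤ Metric.infDist (f x) (A i) :=
        (Metric.le_infDist (hAne i)).2 fun {a} ha => by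
          rw [dist_comm]; exact hrdist i a ha _ h1
      have h3 := abs_le.1 (hvi i)
      have h4 := hδ i
      simp only [g, Pi.sub_apply, Metric.infDist_zero_of_mem h1]
      linarith)
  exact hv ⟨f x, hS x, sub_eq_zero.1 hx⟩

/-- The full simplex spanned by the standard basis. -/
def standardSimplex (m : ℕ) : Geometry.SimplicialComplex ℝ (Fin m → ℝ) where
  faces := {s | s.Nonempty ∧ (s : Set (Fin m → ℝ)) ⊆ Set.range (Pi.basisFun ℝ (Fin m))}
  isRelLowerSet_faces := fun s hs =>
    ⟨hs.1, fun t hts ht => ⟨ht, (Finset.coe_subset.2 hts).trans hs.2⟩⟩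
  indep := fun {s} hs =>
    (Pi.basisFun ℝ (Fin m)).linearIndependent.affineIndependent.range.mono hs.2
  inter_subset_convexHull := fun {s t} hs ht => by
    classical
    refine (AffineIndependent.convexHull_inter' (R := ℝ) ?_).ge
    refine (Pi.basisFun ℝ (Fin m)).linearIndependent.affineIndependent.range.mono ?_
    rw [Finset.coe_union]
    exact Set.union_subset hs.2 ht.2

theorem finite_faces_standardSimplex (m : ℕ) : (standardSimplex m).faces.Finite := by
  refine (Set.finite_range (Pi.basisFun ℝ (Fin m))).finite_subsets.preimage
    Finset.coe_injective.injOn |>.subset fun s hs => hs.2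

theorem card_le_of_mem_faces_standardSimplex {m : ℕ} {s : Finset (Fin m → ℝ)}
    (hs : s ∈ (standardSimplex m).faces) : s.card ≤ m := by
  classical
  have h : s ⊆ Finset.univ.image (Pi.basisFun ℝ (Fin m)) := fun x hx => by
    simpa using hs.2 hx
  simpa using (Finset.card_le_card h).trans Finset.card_image_le

theorem stdSimplex_subset_space_standardSimplex (m : ℕ) :
    stdSimplex ℝ (Fin (m + 1)) ⊆ (standardSimplex (m + 1)).space := by
  classical
  have hmem : Finset.univ.image (Pi.basisFun ℝ (Fin (m + 1))) ∈ (standardSimplex (m + 1)).faces :=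
    ⟨Finset.univ_nonempty.image _, by
      rw [Finset.coe_image, Finset.coe_univ, Set.image_univ]⟩
  refine subset_trans ?_ (Geometry.SimplicialComplex.convexHull_subset_space hmem)
  rw [← convexHull_basis_eq_stdSimplex]
  refine convexHull_mono ?_
  rintro _ ⟨i, rfl⟩
  simp only [Finset.coe_image, Finset.coe_univ, Set.image_univ]
  exact ⟨i, by ext j; simp [Pi.single_apply, eq_comm]⟩

theorem exists_injective_continuous_cube_stdSimplex (n : ℕ) :
    ∃ f : Cube n → (Fin (n + 1) → ℝ), Continuous f ∧ Function.Injective f ∧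
      ∀ x, f x ∈ stdSimplex ℝ (Fin (n + 1)) := by
  refine ⟨fun x => Fin.cons (1 - ∑ i, (x i : ℝ) / (n + 1)) fun i => (x i : ℝ) / (n + 1),
    ?_, fun x y hxy => ?_, fun x => ⟨fun i => ?_, ?_⟩⟩
  · refine continuous_pi fun i => ?_
    refine Fin.cases ?_ (fun j => ?_) i
    · simp only [Fin.cons_zero]; fun_prop
    · simp only [Fin.cons_succ]; fun_prop
  · ext i
    have h := congrFun hxy i.succ
    simp only [Fin.cons_succ] at h
    exact (div_left_inj' (by positivity)).1 h
  · refine Fin.cases ?_ (fun j => ?_) i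
    · have h : ∑ i, (x i : ℝ) / (n + 1) ≤ ∑ _i : Fin n, (1 : ℝ) / (n + 1) := by
        gcongr with i
        exact (x i).2.2
      have h2 : ∑ _i : Fin n, (1 : ℝ) / (n + 1) ≤ 1 := by
        rw [Finset.sum_const, Finset.card_univ, Fintype.card_fin, nsmul_eq_mul, mul_one_div,
          div_le_one (by positivity)]
        linarith
      simp only [Fin.cons_zero]
      linarith
    · simp only [Fin.cons_succ]
      exact div_nonneg (x j).2.1 (by positivity)
  · rw [Fin.sum_univ_succ]
    simp

theorem exists_complex_of_cube (n : ℕ) {ε : ℝ} (h0 : 0 < ε) :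
    ∃ (m : ℕ) (K : Geometry.SimplicialComplex ℝ (Fin m → ℝ)),
      K.faces.Finite ∧ (∀ s ∈ K.faces, s.card ≤ n + 1) ∧
      ∃ f : Cube n → K.space, Continuous f ∧
        ∀ p : K.space, setEDiam cubeDist (f ⁻¹' {p}) < ENNReal.ofReal ε := by
  obtain ⟨f, hf, hinj, hmem⟩ := exists_injective_continuous_cube_stdSimplex n
  refine ⟨n + 1, standardSimplex (n + 1), finite_faces_standardSimplex _,
    fun s hs => card_le_of_mem_faces_standardSimplex hs,
    fun x => ⟨f x, stdSimplex_subset_space_standardSimplex n (hmem x)⟩, by fun_prop, fun p => ?_⟩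
  refine lt_of_le_of_lt (iSup₂_le fun x hx => iSup₂_le fun y hy => ?_) (ENNReal.ofReal_pos.2 h0)
  have hxy : x = y := hinj (congrArg Subtype.val (Eq.trans hx (Eq.symm hy)))
  simp [cubeDist, hxy]

/-- for every `n` and `0 < ε < 1`, `widim_ε([0,1]^n, ‖·‖_∞) = n`. -/
theorem stmt_10 (n : ℕ) (ε : ℝ) (h0 : 0 < ε) (h1 : ε < 1) :
    widim (Cube n) cubeDist ε = n := by
  refine le_antisymm (Nat.sInf_le (exists_complex_of_cube n h0))
    (le_csInf ⟨n, exists_complex_of_cube n h0⟩ ?_)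
  rintro k ⟨m, K, hK, hcard, f, hf, hdiam⟩
  have hsep : ∀ x y i, x i = 0 → y i = 1 → (f x : Fin m → ℝ) ≠ f y := by
    intro x y i hx hy hxy
    have h := (ofReal_le_setEDiam (ρ := cubeDist) (E := f ⁻¹' {f y}) (x := x) (y := y)
      (Subtype.ext hxy) rfl).trans_lt (hdiam (f y))
    rw [ENNReal.ofReal_lt_ofReal_iff h0] at h
    linarith [one_le_cubeDist hx hy]
  have h := (le_dimH_of_separates_opposite_faces (continuous_subtype_val.comp hf) hsep
    fun x => (f x).2).trans (dimH_space_le hK hcard)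
  exact_mod_cast h
end

section
/- Let (X, T) and (Y, S) be dynamical systems with metrics d on X and d' on Y, and let π : (X, T) → (Y, S) be an equivariant continuous map. Then the upper conditional metric mean dimension satisfies upper-mdim_M(π, T, d) = limsup_{ε→0} { lim_{δ→0} ( lim_{N→∞} (sup_{y∈Y} log #(π^{-1}(B_δ(y, d'_N)), d_N, ε)) / (N log(1/ε)) ) }, where B_δ(y, d'_N) = {x ∈ Y : d'_N(x, y) ≤ δ}. -/
open Filter Topology
open scoped ENNReal NNReal

section Covers

variable {X : Type*} {ρ : X → X → ℝ} {ε : ℝ}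

/-- `E` is covered by `n` sets that are `ρ`-open and of `ρ`-diameter `< ε`. -/
def HasCover (ρ : X → X → ℝ) (ε : ℝ) (E : Set X) (n : ℕ) : Prop :=
  ∃ U : Fin n → Set X, (∀ i, ROpen ρ (U i)) ∧
    (∀ i, setEDiam ρ (U i) < ENNReal.ofReal ε) ∧ E ⊆ ⋃ i, U i

lemma HasCover.of_fintype {ι : Type*} [Fintype ι] {E : Set X} (U : ι → Set X)
    (hopen : ∀ i, ROpen ρ (U i)) (hdiam : ∀ i, setEDiam ρ (U i) < ENNReal.ofReal ε)
    (hcov : E ⊆ ⋃ i, U i) : HasCover ρ ε E (Fintype.card ι) := by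
  refine ⟨fun i => U ((Fintype.equivFin ι).symm i), fun i => hopen _, fun i => hdiam _, ?_⟩
  intro x hx
  obtain ⟨i, hi⟩ := Set.mem_iUnion.1 (hcov hx)
  exact Set.mem_iUnion.2 ⟨Fintype.equivFin ι i, by simpa using hi⟩

lemma HasCover.mono {E F : Set X} {n : ℕ} (h : HasCover ρ ε F n) (hEF : E ⊆ F) :
    HasCover ρ ε E n := by
  obtain ⟨U, h₁, h₂, h₃⟩ := h
  exact ⟨U, h₁, h₂, hEF.trans h₃⟩

lemma HasCover.covNum_le {E : Set X} {n : ℕ} (h : HasCover ρ ε E n) : covNum ρ ε E ≤ n :=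
  Nat.sInf_le h

lemma HasCover.hasCover_covNum {E : Set X} {n : ℕ} (h : HasCover ρ ε E n) :
    HasCover ρ ε E (covNum ρ ε E) :=
  Nat.sInf_mem (s := {n | HasCover ρ ε E n}) ⟨n, h⟩

lemma HasCover.log_covNum_le {E F : Set X} {n : ℕ} (h : HasCover ρ ε F n) (hEF : E ⊆ F) :
    Real.log (covNum ρ ε E) ≤ Real.log (covNum ρ ε F) := by
  have hle := (h.hasCover_covNum.mono hEF).covNum_le
  rcases Nat.eq_zero_or_pos (covNum ρ ε E) with h0 | h0
  · simpa [h0] using Real.log_natCast_nonneg _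
  · exact Real.log_le_log (by exact_mod_cast h0) (by exact_mod_cast hle)

lemma HasCover.bddAbove_log_covNum {ι : Type*} {n : ℕ} (h : HasCover ρ ε Set.univ n)
    (E : ι → Set X) : BddAbove (Set.range fun i => Real.log (covNum ρ ε (E i))) := by
  refine ⟨Real.log (covNum ρ ε Set.univ), ?_⟩
  rintro _ ⟨i, rfl⟩
  exact h.log_covNum_le (Set.subset_univ _)

lemma supLogCov_nonneg {Y : Type*} (π : X → Y) : 0 ≤ supLogCov π ρ ε :=
  Real.iSup_nonneg fun _ => Real.log_natCast_nonneg _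

lemma HasCover.covNum_fiber_le_exp {Y : Type*} (π : X → Y) {n : ℕ}
    (h : HasCover ρ ε Set.univ n) (y : Y) :
    (covNum ρ ε (π ⁻¹' {y}) : ℝ) ≤ Real.exp (supLogCov π ρ ε) :=
  (Real.le_exp_log _).trans
    (Real.exp_le_exp.2 (le_ciSup (h.bddAbove_log_covNum fun y : Y => π ⁻¹' {y}) y))

lemma HasCover.supLogCov_le_supLogCovBall {Y : Type*} (π : X → Y) {σ : Y → Y → ℝ} {δ : ℝ}
    (hσ : ∀ y, σ y y ≤ δ) {n : ℕ} (h : HasCover ρ ε Set.univ n) :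
    supLogCov π ρ ε ≤ supLogCovBall π ρ σ ε δ := by
  refine ciSup_mono (h.bddAbove_log_covNum _) fun y => ?_
  refine (h.mono (Set.subset_univ _)).log_covNum_le (Set.preimage_mono ?_)
  rintro z rfl
  exact hσ _

end Covers

section DynamicalDistance

variable {X : Type*} [MetricSpace X] {T : X → X} {N : ℕ}

lemma dynDist_eq_iSup (x y : X) :
    dynDist T dist N x y = ⨆ n : Fin N, dist (T^[n] x) (T^[n] y) := by
  unfold dynDist iSup
  congr 1
  ext r
  constructor
  · rintro ⟨n, hn, rfl⟩
    exact ⟨⟨n, hn⟩, rfl⟩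
  · rintro ⟨n, rfl⟩
    exact ⟨n, n.2, rfl⟩

lemma dynDist_le {x y : X} {r : ℝ} (hr : 0 ≤ r)
    (h : ∀ n < N, dist (T^[n] x) (T^[n] y) ≤ r) : dynDist T dist N x y ≤ r := by
  rw [dynDist_eq_iSup]
  exact Real.iSup_le (fun n => h n n.2) hr

lemma dist_iterate_le_dynDist (x y : X) {n : ℕ} (hn : n < N) :
    dist (T^[n] x) (T^[n] y) ≤ dynDist T dist N x y := by
  rw [dynDist_eq_iSup]
  exact le_ciSup (f := fun n : Fin N => dist (T^[n] x) (T^[n] y))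
    (Set.finite_range _).bddAbove ⟨n, hn⟩

lemma dist_le_dynDist (hN : 0 < N) (x y : X) : dist x y ≤ dynDist T dist N x y :=
  dist_iterate_le_dynDist x y hN

lemma eventually_dynDist_lt (hT : Continuous T) (N : ℕ) (x : X) {r : ℝ} (hr : 0 < r) :
    ∀ᶠ y in 𝓝 x, dynDist T dist N x y < r := by
  have h : ∀ᶠ y in 𝓝 x, ∀ n ∈ Finset.range N, dist (T^[n] x) (T^[n] y) < r / 2 := by
    rw [Filter.eventually_all_finset]
    intro n _
    have hc : Continuous fun y => dist (T^[n] x) (T^[n] y) :=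
      continuous_const.dist (hT.iterate n)
    exact hc.continuousAt.eventually_lt continuousAt_const (by simpa using half_pos hr)
  filter_upwards [h] with y hy
  exact (dynDist_le (half_pos hr).le fun n hn => (hy n (Finset.mem_range.2 hn)).le).trans_lt
    (half_lt_self hr)

lemma ROpen.isOpen_of_dynDist (hT : Continuous T) {U : Set X}
    (hU : ROpen (dynDist T dist N) U) : IsOpen U := by
  rw [isOpen_iff_mem_nhds]
  intro x hx
  obtain ⟨δ, hδ, h⟩ := hU x hx
  exact Filter.mem_of_superset (eventually_dynDist_lt hT N x hδ) fun y hy => h y hy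

lemma IsOpen.rOpen_dynDist (hN : 0 < N) {U : Set X} (hU : IsOpen U) :
    ROpen (dynDist T dist N) U := by
  intro x hx
  obtain ⟨δ, hδ, h⟩ := Metric.isOpen_iff.1 hU x hx
  refine ⟨δ, hδ, fun y hy => h ?_⟩
  rw [Metric.mem_ball, dist_comm]
  exact (dist_le_dynDist hN x y).trans_lt hy

lemma dynDist_triangle_left (x y z : X) :
    dynDist T dist N y z ≤ dynDist T dist N x y + dynDist T dist N x z := by
  have h0 : ∀ a b : X, 0 ≤ dynDist T dist N a b := fun a b => by
    rw [dynDist_eq_iSup]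
    exact Real.iSup_nonneg fun _ => dist_nonneg
  refine dynDist_le (add_nonneg (h0 _ _) (h0 _ _)) fun n hn => ?_
  exact (dist_triangle_left _ _ _).trans
    (add_le_add (dist_iterate_le_dynDist _ _ hn) (dist_iterate_le_dynDist _ _ hn))

lemma exists_hasCover_univ [CompactSpace X] (hT : Continuous T) (hN : 0 < N) {ε : ℝ}
    (hε : 0 < ε) : ∃ n, HasCover (dynDist T dist N) ε Set.univ n := by
  have hnhds : ∀ x ∈ (Set.univ : Set X), interior {y | dynDist T dist N x y < ε / 4} ∈ 𝓝 x :=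
    fun x _ => interior_mem_nhds.2 (eventually_dynDist_lt hT N x (by positivity))
  obtain ⟨t, -, ht⟩ := isCompact_univ.elim_nhds_subcover _ hnhds
  refine ⟨_, HasCover.of_fintype (ι := t)
    (fun x => interior {y | dynDist T dist N (x : X) y < ε / 4})
    (fun x => isOpen_interior.rOpen_dynDist hN) (fun x => ?_) ?_⟩
  · refine lt_of_le_of_lt (b := ENNReal.ofReal (ε / 2)) ?_
      ((ENNReal.ofReal_lt_ofReal_iff hε).2 (half_lt_self hε))
    refine iSup₂_le fun y hy => iSup₂_le fun z hz => ENNReal.ofReal_le_ofReal ?_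
    have hy' : dynDist T dist N (x : X) y < ε / 4 :=
      (interior_subset : _ ⊆ {w | dynDist T dist N (x : X) w < ε / 4}) hy
    have hz' : dynDist T dist N (x : X) z < ε / 4 :=
      (interior_subset : _ ⊆ {w | dynDist T dist N (x : X) w < ε / 4}) hz
    linarith [dynDist_triangle_left (T := T) (N := N) (x : X) y z]
  · intro y hy
    obtain ⟨x, hx, hxy⟩ := Set.mem_iUnion₂.1 (ht hy)
    exact Set.mem_iUnion.2 ⟨⟨x, hx⟩, hxy⟩

/-- Covers of the time-`kM` images for `d_M` combine to a cover for `d_N`, where `N ≤ K M`. -/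
lemma hasCover_iInter_preimage (hT : Continuous T) (hN : 0 < N) {M K : ℕ} (hM : 0 < M)
    (hK : N ≤ K * M) {ε : ℝ} (hε : 0 < ε) (E : Fin K → Set X) (n : Fin K → ℕ)
    (h : ∀ j, HasCover (dynDist T dist M) ε (E j) (n j)) :
    HasCover (dynDist T dist N) ε (⋂ j : Fin K, T^[j * M] ⁻¹' E j) (∏ j, n j) := by
  choose U hopen hdiam hcov using h
  have key := HasCover.of_fintype (ρ := dynDist T dist N) (ε := ε)
    (E := ⋂ j : Fin K, T^[j * M] ⁻¹' E j) (ι := ∀ j, Fin (n j))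
    (fun f => ⋂ j : Fin K, T^[j * M] ⁻¹' U j (f j)) ?_ ?_ ?_
  · simpa using key
  · exact fun f => (isOpen_iInter_of_finite fun j =>
      ((hopen j (f j)).isOpen_of_dynDist hT).preimage (hT.iterate _)).rOpen_dynDist hN
  · intro f
    set c := Finset.univ.sup fun j => setEDiam (dynDist T dist M) (U j (f j))
    have hcε : c < ENNReal.ofReal ε :=
      (Finset.sup_lt_iff (by simpa using hε)).2 fun j _ => hdiam j (f j)
    have hctop : c ≠ ⊤ := (hcε.trans_le le_top).ne
    refine lt_of_le_of_lt (iSup₂_le fun x hx => iSup₂_le fun y hy => ?_) hcε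
    rw [ENNReal.ofReal_le_iff_le_toReal hctop]
    refine dynDist_le ENNReal.toReal_nonneg fun m hm => ?_
    have hj : m / M < K := Nat.div_lt_of_lt_mul (by nlinarith)
    have hx' := Set.mem_iInter.1 hx ⟨m / M, hj⟩
    have hy' := Set.mem_iInter.1 hy ⟨m / M, hj⟩
    have hiter : ∀ z, T^[m] z = T^[m % M] (T^[m / M * M] z) := fun z => by
      rw [← Function.iterate_add_apply, mul_comm, Nat.mod_add_div]
    rw [hiter x, hiter y]
    refine (dist_iterate_le_dynDist _ _ (Nat.mod_lt _ hM)).trans ?_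
    rw [← ENNReal.ofReal_le_iff_le_toReal hctop]
    refine le_trans ?_ (Finset.le_sup (f := fun j => setEDiam (dynDist T dist M) (U j (f j)))
      (Finset.mem_univ ⟨m / M, hj⟩))
    exact le_iSup₂_of_le _ hx' (le_iSup₂_of_le _ hy' le_rfl)
  · intro x hx
    have hx' : ∀ j : Fin K, ∃ i, T^[j * M] x ∈ U j i := fun j =>
      Set.mem_iUnion.1 (hcov j (Set.mem_iInter.1 hx j))
    choose f hf using hx'
    exact Set.mem_iUnion.2 ⟨f, Set.mem_iInter.2 hf⟩

end DynamicalDistance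

section Factor

variable {X Y : Type*} [MetricSpace X] [CompactSpace X] [MetricSpace Y] [CompactSpace Y]
  {T : X → X} {S : Y → Y} {π : X → Y}

lemma exists_hasCover_preimage_closedBall (hT : Continuous T) (hπ : Continuous π) {M : ℕ}
    (hM : 0 < M) {ε : ℝ} (hε : 0 < ε) :
    ∃ δ > 0, ∀ y, ∃ n : ℕ, HasCover (dynDist T dist M) ε (π ⁻¹' Metric.closedBall y δ) n ∧
      (n : ℝ) ≤ Real.exp (supLogCov π (dynDist T dist M) ε) := by
  obtain ⟨n₀, hn₀⟩ := exists_hasCover_univ hT hM hε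
  choose U hopen hdiam hcov using fun y : Y =>
    (hn₀.mono (Set.subset_univ (π ⁻¹' {y}))).hasCover_covNum
  have hW : ∀ y, IsOpen (π '' (⋃ i, U y i)ᶜ)ᶜ := fun y =>
    (hπ.isClosedMap _ (isOpen_iUnion fun i =>
      (hopen y i).isOpen_of_dynDist hT).isClosed_compl).isOpen_compl
  obtain ⟨δ, hδ, h⟩ := lebesgue_number_lemma_of_metric (isCompact_univ (X := Y)) hW
    (fun y _ => Set.mem_iUnion.2 ⟨y, by
      rintro ⟨x, hx, rfl⟩
      exact hx (hcov _ rfl)⟩)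
  refine ⟨δ / 2, half_pos hδ, fun y => ?_⟩
  obtain ⟨z, hz⟩ := h y (Set.mem_univ y)
  refine ⟨_, ⟨U z, hopen z, hdiam z, fun x hx => ?_⟩, hn₀.covNum_fiber_le_exp π z⟩
  by_contra hxU
  exact hz (Metric.closedBall_subset_ball (half_lt_self hδ) hx) ⟨x, hxU, rfl⟩

lemma exists_supLogCovBall_le (hT : Continuous T) (hπ : Continuous π)
    (hequiv : Function.Semiconj π T S) {M : ℕ} (hM : 0 < M) {ε : ℝ} (hε : 0 < ε) :
    ∃ δ₀ > 0, ∀ δ ≤ δ₀, ∀ N > 0,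
      supLogCovBall π (dynDist T dist N) (dynDist S dist N) ε δ ≤
        (N / M + 1) * supLogCov π (dynDist T dist M) ε := by
  obtain ⟨δ₀, hδ₀, h⟩ := exists_hasCover_preimage_closedBall hT hπ hM hε
  refine ⟨δ₀, hδ₀, fun δ hδ N hN => ?_⟩
  set s := supLogCov π (dynDist T dist M) ε
  have hs0 : 0 ≤ s := supLogCov_nonneg π
  refine Real.iSup_le (fun y => ?_) (by positivity)
  set K := (N - 1) / M + 1 with hKdef
  have hNK : N ≤ K * M := by
    have := Nat.lt_div_mul_add (a := N - 1) hM
    rw [hKdef, add_mul, one_mul]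
    omega
  choose n hcov hn using fun j : Fin K => h (S^[j * M] y)
  have hcov' := (hasCover_iInter_preimage hT hN hM hNK hε _ n hcov).mono
    (E := π ⁻¹' {x | dynDist S dist N x y ≤ δ}) (by
      intro x hx
      refine Set.mem_iInter.2 fun j => ?_
      have hj : (j : ℕ) * M < N := by
        have h1 : (j : ℕ) ≤ (N - 1) / M := Nat.lt_succ_iff.1 j.2
        have h2 := (Nat.mul_le_mul_right M h1).trans (Nat.div_mul_le_self (N - 1) M)
        omega
      change dist (π (T^[j * M] x)) (S^[j * M] y) ≤ δ₀
      rw [(hequiv.iterate_right _).eq]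
      exact (dist_iterate_le_dynDist _ _ hj).trans (le_trans hx hδ))
  rcases Nat.eq_zero_or_pos
    (covNum (dynDist T dist N) ε (π ⁻¹' {x | dynDist S dist N x y ≤ δ})) with h0 | h0
  · rw [h0]
    simpa using by positivity
  · have hle : (covNum (dynDist T dist N) ε (π ⁻¹' {x | dynDist S dist N x y ≤ δ}) : ℝ) ≤
        Real.exp (K * s) := by
      refine (Nat.cast_le.2 hcov'.covNum_le).trans ?_
      rw [Real.exp_nat_mul]
      push_cast
      refine (Finset.prod_le_prod (fun _ _ => Nat.cast_nonneg _) fun j _ => hn j).trans ?_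
      simp
    refine ((Real.log_le_iff_le_exp (by exact_mod_cast h0)).2 hle).trans ?_
    gcongr
    have : (((N - 1) / M : ℕ) : ℝ) ≤ N / M :=
      Nat.cast_div_le.trans (by gcongr; omega)
    rw [hKdef]
    push_cast
    linarith

lemma tendsto_add_one_mul_div (s L : ℝ) {M : ℕ} (hM : 0 < M) :
    Tendsto (fun N : ℕ => ((N : ℝ) / M + 1) * s / (N * L)) atTop (𝓝 (s / (M * L))) := by
  have h : Tendsto (fun N : ℕ => ((M : ℝ)⁻¹ + (N : ℝ)⁻¹) * (s / L)) atTop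
      (𝓝 (((M : ℝ)⁻¹ + 0) * (s / L))) :=
    (tendsto_const_nhds.add tendsto_inv_atTop_nhds_zero_nat).mul_const _
  have hlim : ((M : ℝ)⁻¹ + 0) * (s / L) = s / (M * L) := by
    rw [add_zero, div_eq_mul_inv, div_eq_mul_inv, mul_inv]
    ring
  rw [hlim] at h
  refine h.congr' ?_
  filter_upwards [eventually_gt_atTop 0] with N hN
  have : (N : ℝ) ≠ 0 := by exact_mod_cast hN.ne'
  rcases eq_or_ne L 0 with rfl | hL
  · simp
  · field_simp

lemma condMdimRate_eq_liminf_supLogCovBall (hT : Continuous T) (hπ : Continuous π)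
    (hequiv : Function.Semiconj π T S) {ε : ℝ} (hε : 0 < ε) (hε1 : ε < 1) :
    condMdimRate π T dist ε =
      Filter.liminf (fun δ : ℝ =>
        Filter.liminf (fun N : ℕ =>
          ((supLogCovBall π (dynDist T dist N) (dynDist S dist N) ε δ /
              (N * Real.log (1 / ε)) : ℝ) : EReal)) Filter.atTop)
        (𝓝[>] (0 : ℝ)) := by
  have hL : 0 < Real.log (1 / ε) := Real.log_pos (by rwa [lt_div_iff₀ hε, one_mul])
  apply le_antisymm
  · refine le_liminf_of_le (by isBoundedDefault) ?_
    filter_upwards [self_mem_nhdsWithin] with δ hδ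
    refine liminf_le_liminf ?_
    filter_upwards [eventually_gt_atTop 0] with N hN
    obtain ⟨n, hn⟩ := exists_hasCover_univ hT hN hε
    refine EReal.coe_le_coe_iff.2 (div_le_div_of_nonneg_right ?_ (by positivity))
    exact hn.supLogCov_le_supLogCovBall π
      fun y => dynDist_le (le_of_lt hδ) fun n _ => by simpa using le_of_lt hδ
  · refine le_liminf_of_le (by isBoundedDefault) ?_
    filter_upwards [eventually_gt_atTop 0] with M hM
    obtain ⟨δ₀, hδ₀, h⟩ := exists_supLogCovBall_le hT hπ hequiv hM hε
    refine (liminf_le_liminf (v := fun _ => _) ?_).trans_eq (liminf_const _)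
    filter_upwards [Ioc_mem_nhdsGT hδ₀] with δ hδ
    rw [← ((continuous_coe_real_ereal.tendsto _).comp
      (tendsto_add_one_mul_div (supLogCov π (dynDist T dist M) ε) _ hM)).liminf_eq]
    refine liminf_le_liminf ?_
    filter_upwards [eventually_gt_atTop 0] with N hN
    exact EReal.coe_le_coe_iff.2 (div_le_div_of_nonneg_right (h δ hδ.2 N hN) (by positivity))

end Factor

/-- the upper conditional metric mean dimension equals
`limsup_{ε→0} lim_{δ→0} lim_{N→∞} (sup_y log #(π⁻¹(B_δ(y, d'_N)), d_N, ε))/(N log(1/ε))`. -/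
theorem stmt_13 (X Y : Type) [MetricSpace X] [CompactSpace X]
    [MetricSpace Y] [CompactSpace Y] (T : X ≃ₜ X) (S : Y ≃ₜ Y)
    (π : X → Y) (hcont : Continuous π) (hequiv : ∀ x, π (T x) = S (π x)) :
    upperCondMdimM π (⇑T) dist =
      Filter.limsup (fun ε : ℝ =>
        Filter.liminf (fun δ : ℝ =>
          Filter.liminf (fun N : ℕ =>
            ((supLogCovBall π (dynDist (⇑T) dist N) (dynDist (⇑S) dist N) ε δ /
                (N * Real.log (1 / ε)) : ℝ) : EReal)) Filter.atTop)
          (𝓝[>] (0 : ℝ)))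
        (𝓝[>] (0 : ℝ)) := by
  refine limsup_congr ?_
  filter_upwards [Ioo_mem_nhdsGT one_pos] with ε hε
  exact condMdimRate_eq_liminf_supLogCovBall T.continuous hcont hequiv hε.1 hε.2
end

section
/- Let s ≥ 0 be a real number and let (X, T) be a dynamical system with a metric d on X. Suppose there exist sequences of natural numbers (N_n), (M_n) and continuous maps ψ_n : [0,1]^{M_n} → X such that N_n → +∞, M_n/N_n → s as n → ∞, and ‖x − y‖_∞ ≤ d_{N_n}(ψ_n(x), ψ_n(y)) for all x, y ∈ [0,1]^{M_n}. Then the mean dimension of (X, T) satisfies mdim(X, T) ≥ s. -/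
open Filter Topology
open scoped ENNReal NNReal

/-- The map `ℕ → ℕ` skipping the value `j`. -/
def skipIndex (j i : ℕ) : ℕ := if i < j then i else i + 1

/-- The value of the cochain `a ⌣ db₀ ⌣ ⋯ ⌣ db₍ₘ₋₁₎` on the simplex `w 0, …, w m`, mod 2. -/
def cupCochain {V : Type*} {m : ℕ} (a : V → ZMod 2) (b : Fin m → V → ZMod 2) (w : ℕ → V) :
    ZMod 2 :=
  a (w 0) * ∏ i : Fin m, (b i (w (i + 1)) - b i (w i))

theorem cupCochain_congr {V : Type*} {m : ℕ} (a : V → ZMod 2) (b : Fin m → V → ZMod 2)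
    {w w' : ℕ → V} (h : ∀ i ≤ m, w i = w' i) : cupCochain a b w = cupCochain a b w' := by
  unfold cupCochain
  rw [h 0 (Nat.zero_le _)]
  congr 1
  refine Finset.prod_congr rfl fun i _ => ?_
  rw [h i (by omega), h (i + 1) (by omega)]

/-- The coboundary of `a ⌣ db₀ ⌣ ⋯ ⌣ db₍ₘ₋₁₎` is `da ⌣ db₀ ⌣ ⋯ ⌣ db₍ₘ₋₁₎`. -/
theorem sum_cupCochain_skipIndex {V : Type*} {m : ℕ} (a : V → ZMod 2) (b : Fin m → V → ZMod 2)
    (v : ℕ → V) :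
    ∑ j ∈ Finset.range (m + 2), cupCochain a b (v ∘ skipIndex j) =
      (a (v 1) - a (v 0)) * ∏ i : Fin m, (b i (v (i + 2)) - b i (v (i + 1))) := by
  induction m with
  | zero =>
    simp [cupCochain, Finset.sum_range_succ, skipIndex, CharTwo.sub_eq_add]
  | succ m ih =>
    have key : ∀ w : ℕ → V, cupCochain a b w = cupCochain a (fun i : Fin m => b i.castSucc) w *
        (b (Fin.last m) (w (m + 1)) - b (Fin.last m) (w m)) := by
      intro w
      simp [cupCochain, Fin.prod_univ_castSucc, mul_assoc]
    have e1 : cupCochain a (fun i : Fin m => b i.castSucc) (v ∘ skipIndex (m + 2)) =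
        cupCochain a (fun i : Fin m => b i.castSucc) (v ∘ skipIndex (m + 1)) := by
      refine cupCochain_congr _ _ fun i hi => ?_
      simp [skipIndex, show i < m + 2 by omega, show i < m + 1 by omega]
    have e2 : ∀ j ∈ Finset.range (m + 1), cupCochain a b (v ∘ skipIndex j) =
        cupCochain a (fun i : Fin m => b i.castSucc) (v ∘ skipIndex j) *
        (b (Fin.last m) (v (m + 2)) - b (Fin.last m) (v (m + 1))) := by
      intro j hj
      rw [Finset.mem_range] at hj
      rw [key]
      simp [skipIndex, show ¬ m + 1 < j by omega, show ¬ m < j by omega]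
    have h := ih (fun i : Fin m => b i.castSucc)
    rw [Finset.sum_range_succ] at h
    rw [Finset.sum_range_succ, Finset.sum_range_succ, Finset.sum_congr rfl e2, ← Finset.sum_mul,
      key, key, e1, Fin.prod_univ_castSucc, ← mul_assoc]
    simp only [Fin.val_castSucc, Fin.val_last]
    rw [← h]
    simp only [skipIndex, Function.comp_apply, lt_irrefl, if_false, Nat.lt_succ_self, if_true,
      show m < m + 2 by omega]
    ring_nf
    simp only [CharTwo.sub_eq_add]
    have two : ∀ z : ZMod 2, z * 2 = 0 := by decide
    ring_nf
    simp [two]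

/-- The path through the lattice starting at `x` which at time `i` moves in the direction `a` with
`σ a = i`. Its first `d + 1` points are the vertices of a simplex of the Kuhn triangulation. -/
def kuhnPath {d : ℕ} (x : Fin d → ℕ) (σ : Equiv.Perm (Fin d)) (j : ℕ) : Fin d → ℕ :=
  fun a => x a + if (σ a : ℕ) < j then 1 else 0

theorem kuhnPath_swap {d : ℕ} (x : Fin d → ℕ) (σ : Equiv.Perm (Fin d)) {j i : ℕ} (hj : j + 1 < d)
    (hi : i ≠ j + 1) :
    kuhnPath x (Equiv.swap ⟨j, by omega⟩ ⟨j + 1, hj⟩ * σ) i = kuhnPath x σ i := by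
  funext a
  simp only [kuhnPath, Equiv.Perm.mul_apply, Equiv.swap_apply_def]
  split_ifs <;> simp_all [Fin.ext_iff] <;> omega

theorem sum_cupCochain_interior {m : ℕ} (a : (Fin (m + 1) → ℕ) → ZMod 2)
    (b : Fin m → (Fin (m + 1) → ℕ) → ZMod 2) (x : Fin (m + 1) → ℕ) {j : ℕ} (hj : j < m) :
    ∑ σ : Equiv.Perm (Fin (m + 1)), cupCochain a b (kuhnPath x σ ∘ skipIndex (j + 1)) = 0 := by
  have hs : ∀ σ : Equiv.Perm (Fin (m + 1)),
      kuhnPath x (Equiv.swap ⟨j, by omega⟩ ⟨j + 1, by omega⟩ * σ) ∘ skipIndex (j + 1) =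
        kuhnPath x σ ∘ skipIndex (j + 1) := by
    intro σ
    funext i
    refine kuhnPath_swap x σ (by omega) ?_
    unfold skipIndex
    split_ifs <;> omega
  refine Finset.sum_involution
    (fun σ _ => Equiv.swap ⟨j, by omega⟩ ⟨j + 1, by omega⟩ * σ) ?_ ?_ ?_ ?_
  · intro σ _
    rw [hs, CharTwo.add_self_eq_zero]
  · intro σ _ _ h
    have := mul_eq_right.mp h
    rw [Equiv.swap_eq_one_iff] at this
    simp at this
  · simp
  · intro σ _
    simp [← mul_assoc]

/-- The vertices of the facet, orthogonal to the direction `σ⁻¹ 0`, starting at `x`. -/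
def kuhnFacetPath {m : ℕ} (x : Fin (m + 1) → ℕ) (σ : Equiv.Perm (Fin (m + 1))) (i : ℕ) :
    Fin (m + 1) → ℕ :=
  fun a => x a + if σ a ≠ 0 ∧ (σ a : ℕ) < i + 1 then 1 else 0

theorem kuhnPath_comp_skipIndex_zero {m : ℕ} (x : Fin (m + 1) → ℕ)
    (σ : Equiv.Perm (Fin (m + 1))) :
    kuhnPath x σ ∘ skipIndex 0 =
      kuhnFacetPath (Function.update x (σ.symm 0) (x (σ.symm 0) + 1)) σ := by
  funext i a
  by_cases h : a = σ.symm 0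
  · subst h
    simp [kuhnPath, kuhnFacetPath, skipIndex]
  · have : σ a ≠ 0 := fun h' => h (by rw [← h', Equiv.symm_apply_apply])
    simp [kuhnPath, kuhnFacetPath, skipIndex, h, this]

theorem kuhnPath_finRotate_symm {m : ℕ} (x : Fin (m + 1) → ℕ)
    (σ : Equiv.Perm (Fin (m + 1))) {i : ℕ} (hi : i ≤ m) :
    kuhnPath x ((finRotate (m + 1)).symm * σ) i = kuhnFacetPath x σ i := by
  funext a
  simp only [kuhnPath, kuhnFacetPath]
  congr 1
  refine if_congr ?_ rfl rfl
  obtain ⟨k, hk⟩ := (finRotate (m + 1)).surjective (σ a)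
  rw [Equiv.Perm.mul_apply, ← hk, Equiv.symm_apply_apply]
  rcases Fin.eq_castSucc_or_eq_last k with ⟨k, rfl⟩ | rfl
  · rw [finRotate_of_lt (by simp)]
    simp [Fin.ext_iff]
  · simp
    omega

theorem sum_cupCochain_last {m : ℕ} (a : (Fin (m + 1) → ℕ) → ZMod 2)
    (b : Fin m → (Fin (m + 1) → ℕ) → ZMod 2) (x : Fin (m + 1) → ℕ) :
    ∑ σ : Equiv.Perm (Fin (m + 1)), cupCochain a b (kuhnPath x σ ∘ skipIndex (m + 1)) =
      ∑ σ : Equiv.Perm (Fin (m + 1)), cupCochain a b (kuhnFacetPath x σ) := by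
  rw [← Equiv.sum_comp (Equiv.mulLeft (finRotate (m + 1)).symm)]
  refine Finset.sum_congr rfl fun σ _ => cupCochain_congr _ _ fun i hi => ?_
  rw [← kuhnPath_finRotate_symm x σ hi]
  simp [skipIndex, show i < m + 1 by omega]

theorem sum_fin_pi_insertNth {m n : ℕ} (p : Fin (m + 1)) (F : (Fin (m + 1) → ℕ) → ZMod 2) :
    ∑ x : Fin (m + 1) → Fin n, F (fun i => x i) =
      ∑ y : Fin m → Fin n, ∑ t ∈ Finset.range n, F (p.insertNth t fun i => (y i : ℕ)) := by
  rw [← Equiv.sum_comp (Fin.insertNthEquiv (fun _ => Fin n) p), Fintype.sum_prod_type,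
    Finset.sum_comm]
  refine Finset.sum_congr rfl fun y _ => ?_
  rw [Finset.sum_range]
  refine Finset.sum_congr rfl fun t _ => ?_
  congr 1
  funext i
  refine Fin.succAboveCases p ?_ (fun i => ?_) i <;> simp [Fin.insertNthEquiv]

theorem sum_cupCochain_boundary {m n : ℕ} (a : (Fin (m + 1) → ℕ) → ZMod 2)
    (b : Fin m → (Fin (m + 1) → ℕ) → ZMod 2) (σ : Equiv.Perm (Fin (m + 1))) :
    ∑ x : Fin (m + 1) → Fin n,
        (cupCochain a b (kuhnPath (fun i => (x i : ℕ)) σ ∘ skipIndex 0) +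
          cupCochain a b (kuhnFacetPath (fun i => (x i : ℕ)) σ)) =
      ∑ y : Fin m → Fin n,
        (cupCochain a b (kuhnFacetPath ((σ.symm 0).insertNth n fun i => (y i : ℕ)) σ) +
          cupCochain a b (kuhnFacetPath ((σ.symm 0).insertNth 0 fun i => (y i : ℕ)) σ)) := by
  rw [sum_fin_pi_insertNth (σ.symm 0) (fun x => cupCochain a b (kuhnPath x σ ∘ skipIndex 0) +
          cupCochain a b (kuhnFacetPath x σ))]
  refine Finset.sum_congr rfl fun y _ => ?_
  simp only [← CharTwo.sub_eq_add]
  rw [← Finset.sum_range_sub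
    (fun t => cupCochain a b (kuhnFacetPath ((σ.symm 0).insertNth t fun i => (y i : ℕ)) σ))]
  refine Finset.sum_congr rfl fun t _ => ?_
  rw [kuhnPath_comp_skipIndex_zero]
  simp [Fin.update_insertNth]

/-- A cubical form of Sperner's lemma: if `c i` is `0` on the face `x i = 0` and `1` on the
opposite face `x i = n`, then the number of simplices `v 0, …, v d` of the Kuhn triangulation for
which every `c i` changes along the edge from `v i` to `v (i + 1)` is odd. -/
theorem sum_kuhnPath_eq_one {d n : ℕ} (c : Fin d → (Fin d → ℕ) → ZMod 2)
    (h0 : ∀ i x, x i = 0 → c i x = 0) (h1 : ∀ i x, x i = n → c i x = 1) :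
    ∑ x : Fin d → Fin n, ∑ σ : Equiv.Perm (Fin d), ∏ i : Fin d,
      (c i (kuhnPath (fun a => (x a : ℕ)) σ (i + 1)) - c i (kuhnPath (fun a => (x a : ℕ)) σ i)) =
      1 := by
  induction d with
  | zero => simp
  | succ m ih =>
    have hL : ∀ (x : Fin (m + 1) → ℕ) (σ : Equiv.Perm (Fin (m + 1))),
        ∏ i, (c i (kuhnPath x σ (i + 1)) - c i (kuhnPath x σ i)) =
        ∑ j ∈ Finset.range (m + 2),
          cupCochain (c 0) (fun i => c i.succ) (kuhnPath x σ ∘ skipIndex j) := by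
      intro x σ
      rw [sum_cupCochain_skipIndex, Fin.prod_univ_succ]
      simp
    have hx : ∀ x : Fin (m + 1) → ℕ, ∑ σ : Equiv.Perm (Fin (m + 1)),
        ∏ i, (c i (kuhnPath x σ (i + 1)) - c i (kuhnPath x σ i)) =
        ∑ σ : Equiv.Perm (Fin (m + 1)),
          (cupCochain (c 0) (fun i => c i.succ) (kuhnPath x σ ∘ skipIndex 0) +
            cupCochain (c 0) (fun i => c i.succ) (kuhnFacetPath x σ)) := by
      intro x
      simp only [hL]
      rw [Finset.sum_comm, Finset.sum_range_succ, Finset.sum_range_succ', sum_cupCochain_last,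
        Finset.sum_eq_zero, zero_add, Finset.sum_add_distrib]
      intro j hj
      exact sum_cupCochain_interior _ _ _ (Finset.mem_range.mp hj)
    simp only [hx]
    rw [Finset.sum_comm]
    simp only [sum_cupCochain_boundary]
    have hconst : ∀ (σ : Equiv.Perm (Fin (m + 1))) (t : ℕ) (y : Fin m → ℕ) (i : ℕ),
        kuhnFacetPath ((σ.symm 0).insertNth t y) σ i (σ.symm 0) = t := by
      intro σ t y i
      simp [kuhnFacetPath]
    rw [← Equiv.sum_comp Equiv.Perm.decomposeFin.symm, Fintype.sum_prod_type, Fin.sum_univ_succ,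
      Finset.sum_eq_zero (s := Finset.univ (α := Fin m)), add_zero]
    · rw [← ih (fun i y => c i.succ (Fin.cons n y)) (fun i x hx => h0 _ _ (by simpa using hx))
        (fun i x hx => h1 _ _ (by simpa using hx)), Finset.sum_comm]
      refine Finset.sum_congr rfl fun y _ => Finset.sum_congr rfl fun e _ => ?_
      have hz : (Equiv.Perm.decomposeFin.symm ((0 : Fin (m + 1)), e)).symm 0 = 0 := by
        rw [Equiv.symm_apply_eq, Equiv.Perm.decomposeFin_symm_apply_zero]
      have hc0 : ∀ t, kuhnFacetPath (Fin.insertNth (0 : Fin (m + 1)) t fun i => (y i : ℕ))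
          (Equiv.Perm.decomposeFin.symm ((0 : Fin (m + 1)), e)) 0 0 = t := by
        intro t
        simp [kuhnFacetPath]
      rw [hz]
      unfold cupCochain
      rw [h1 0 _ (hc0 n), h0 0 _ (hc0 0), one_mul, zero_mul, add_zero]
      refine Finset.prod_congr rfl fun i _ => ?_
      have hp : ∀ j : ℕ, kuhnFacetPath (Fin.insertNth (0 : Fin (m + 1)) n fun i => (y i : ℕ))
          (Equiv.Perm.decomposeFin.symm ((0 : Fin (m + 1)), e)) j =
          Fin.cons n (kuhnPath (fun a => (y a : ℕ)) e j) := by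
        intro j
        funext q
        refine Fin.cases ?_ (fun q => ?_) q
        · simp [kuhnFacetPath]
        · simp [kuhnFacetPath, kuhnPath, Equiv.Perm.decomposeFin_symm_apply_succ]
      simp only [hp]
    · intro p _
      refine Finset.sum_eq_zero fun e _ => Finset.sum_eq_zero fun y _ => ?_
      set σ := Equiv.Perm.decomposeFin.symm (p.succ, e) with hσ
      have hne : σ.symm 0 ≠ 0 := by
        rw [Ne, Equiv.symm_apply_eq, hσ, Equiv.Perm.decomposeFin_symm_apply_zero]
        exact (Fin.succ_ne_zero p).symm
      obtain ⟨k, hk⟩ := Fin.exists_succ_eq.mpr hne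
      have hzero : ∀ t, (∀ x, x k.succ = t → c k.succ x = c k.succ (fun _ => t)) →
          cupCochain (c 0) (fun i => c i.succ)
          (kuhnFacetPath ((σ.symm 0).insertNth t fun i => (y i : ℕ)) σ) = 0 := by
        intro t ht
        unfold cupCochain
        rw [Finset.prod_eq_zero (Finset.mem_univ k), mul_zero]
        have hv : ∀ j : ℕ, c k.succ
            (kuhnFacetPath ((σ.symm 0).insertNth t fun i => (y i : ℕ)) σ j) =
              c k.succ (fun _ => t) := fun j => ht _ (by rw [hk]; exact hconst ..)
        beta_reduce
        rw [hv, hv, sub_self]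
      rw [hzero n fun x hx => by rw [h1 _ _ hx, h1 _ _ rfl],
        hzero 0 fun x hx => by rw [h0 _ _ hx, h0 _ _ rfl], add_zero]

/-- The **Poincaré–Miranda theorem**, with strict sign conditions. -/
theorem exists_forall_eq_zero_of_cube {d : ℕ} (f : Fin d → Cube d → ℝ)
    (hf : ∀ i, Continuous (f i)) (h0 : ∀ i x, x i = 0 → f i x < 0)
    (h1 : ∀ i x, x i = 1 → 0 < f i x) : ∃ z, ∀ i, f i z = 0 := by
  by_contra! hne
  have hpos : ∀ z ∈ (Set.univ : Set (Cube d)), 0 < ∑ i, |f i z| := by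
    intro z _
    obtain ⟨i, hi⟩ := hne z
    exact Finset.sum_pos' (fun _ _ => abs_nonneg _) ⟨i, Finset.mem_univ i, abs_pos.mpr hi⟩
  have hcont : Continuous fun z => ∑ i, |f i z| :=
    continuous_finsetSum _ fun i _ => (hf i).abs
  obtain ⟨η, hη, hle⟩ := isCompact_univ.exists_forall_le' hcont.continuousOn hpos
  have huc : UniformContinuous fun z : Cube d => fun i => f i z :=
    CompactSpace.uniformContinuous_of_continuous (continuous_pi hf)
  obtain ⟨δ, hδ, hclose⟩ := Metric.uniformContinuous_iff.mp huc (η / (d + 1)) (by positivity)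
  obtain ⟨n, hn⟩ := exists_nat_one_div_lt hδ
  have hn1 : (0 : ℝ) < ((n + 1 : ℕ) : ℝ) := by positivity
  let p : (Fin d → ℕ) → Cube d := fun x a =>
    Set.projIcc (0 : ℝ) 1 zero_le_one ((x a : ℝ) / ((n + 1 : ℕ) : ℝ))
  have hp : ∀ (x : Fin d → ℕ) (σ : Equiv.Perm (Fin d)) (j : ℕ),
      dist (p (kuhnPath x σ j)) (p x) < δ := by
    intro x σ j
    refine lt_of_le_of_lt ((dist_pi_le_iff (by positivity)).mpr fun a => ?_) hn
    refine (((LipschitzWith.projIcc zero_le_one).dist_le_mul _ _).trans ?_)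
    rw [NNReal.coe_one, one_mul, Real.dist_eq, ← sub_div, abs_div, abs_of_pos hn1]
    push_cast
    gcongr
    simp only [kuhnPath]
    split_ifs <;> simp
  let c : Fin d → (Fin d → ℕ) → ZMod 2 := fun i x => if 0 < f i (p x) then 1 else 0
  have key := sum_kuhnPath_eq_one (n := n + 1) c
    (fun i x hx => by
      have : p x i = 0 := by
        simp [p, hx, Set.projIcc_left]
      simp [c, (h0 i _ this).le])
    (fun i x hx => by
      have : p x i = 1 := by
        simp only [p, hx]
        rw [div_self hn1.ne']
        exact Set.projIcc_right _
      simp [c, h1 i _ this])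
  obtain ⟨x, -, hx⟩ := Finset.exists_ne_zero_of_sum_ne_zero (key.trans_ne one_ne_zero)
  obtain ⟨σ, -, hσ⟩ := Finset.exists_ne_zero_of_sum_ne_zero hx
  rw [Finset.prod_ne_zero_iff] at hσ
  have hsmall : ∀ i ∈ Finset.univ, |f i (p fun a => (x a : ℕ))| ≤ η / (d + 1) := by
    intro i hi
    have hc := hσ i hi
    have hd : ∀ j, |f i (p (kuhnPath (fun a => (x a : ℕ)) σ j)) - f i (p fun a => (x a : ℕ))|
        < η / (d + 1) := by
      intro j
      rw [← Real.dist_eq]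
      exact (dist_le_pi_dist _ _ i).trans_lt (hclose (hp _ σ j))
    have ha := abs_lt.mp (hd i)
    have hb := abs_lt.mp (hd (i + 1))
    simp only [c] at hc
    rw [abs_le]
    split_ifs at hc with u v v
    · simp at hc
    · constructor <;> linarith
    · constructor <;> linarith
    · simp at hc
  have h2 := hle (p fun a => (x a : ℕ)) (Set.mem_univ _)
  have h3 := h2.trans (Finset.sum_le_card_nsmul _ _ _ hsmall)
  rw [Finset.card_univ, Fintype.card_fin, nsmul_eq_mul, mul_div_assoc', le_div_iff₀ (by positivity)]
    at h3
  nlinarith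

/-- Pairwise disjoint closed neighbourhoods of opposite faces of a cube cannot cover it. -/
theorem exists_notMem_of_disjoint_opposite {d : ℕ} (P Q : Fin d → Set (Cube d))
    (hP : ∀ i, IsClosed (P i)) (hQ : ∀ i, IsClosed (Q i)) (hPQ : ∀ i, Disjoint (P i) (Q i))
    (h0 : ∀ i x, x i = 0 → x ∈ P i) (h1 : ∀ i x, x i = 1 → x ∈ Q i) :
    ∃ z, ∀ i, z ∉ P i ∧ z ∉ Q i := by
  choose f hfP hfQ _ using fun i => exists_continuous_zero_one_of_isClosed (hP i) (hQ i) (hPQ i)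
  obtain ⟨z, hz⟩ := exists_forall_eq_zero_of_cube (fun i x => f i x - 1 / 2)
    (fun i => (f i).continuous.sub continuous_const)
    (fun i x hx => by simp [hfP i (h0 i x hx)])
    (fun i x hx => by
      have := hfQ i (h1 i x hx)
      simp only [Pi.one_apply] at this
      norm_num [this])
  refine ⟨z, fun i => ⟨fun hi => ?_, fun hi => ?_⟩⟩
  · have := hfP i hi
    have := hz i
    simp_all
  · have := hfQ i hi
    have := hz i
    norm_num [*] at *

/-- `E` is covered by countably many affine subspaces of dimension less than `e`. -/
def CoveredByFlats {r : ℕ} (e : ℕ) (E : Set (Fin r → ℝ)) : Prop :=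
  ∃ C : Set (AffineSubspace ℝ (Fin r → ℝ)), C.Countable ∧
    (∀ L ∈ C, Module.finrank ℝ L.direction < e) ∧ ∀ p ∈ E, ∃ L ∈ C, p ∈ L

/-- The grid of all coordinate hyperplanes `p i = t + δ * z` with `z` an integer. -/
def gridHyperplanes (r : ℕ) (δ t : ℝ) : Set (Fin r → ℝ) :=
  {p | ∃ (i : Fin r) (z : ℤ), p i = t + δ * z}

/-- The coordinate hyperplane `p i = s`. -/
def coordHyperplane {r : ℕ} (i : Fin r) (s : ℝ) : AffineSubspace ℝ (Fin r → ℝ) where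
  carrier := {p | p i = s}
  smul_vsub_vadd_mem' c p q u hp hq hu := by
    simp only [Set.mem_ofPred_eq] at *
    simp [hp, hq, hu]

theorem mem_coordHyperplane {r : ℕ} {i : Fin r} {s : ℝ} {p : Fin r → ℝ} :
    p ∈ coordHyperplane i s ↔ p i = s := Iff.rfl

/-- All but countably many grids cut the dimension of a set covered by countably many flats. -/
theorem CoveredByFlats.exists_countable {r e : ℕ} {E : Set (Fin r → ℝ)} (h : CoveredByFlats e E)
    (δ : ℝ) : ∃ A : Set ℝ, A.Countable ∧ ∀ t ∉ A,
      CoveredByFlats (e - 1) (E ∩ gridHyperplanes r δ t) := by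
  obtain ⟨C, hC, hdim, hcov⟩ := h
  refine ⟨⋃ L ∈ C, ⋃ i : Fin r, ⋃ z : ℤ,
    {t | (L : Set (Fin r → ℝ)).Nonempty ∧ L ≤ coordHyperplane i (t + δ * z)}, ?_, fun t ht => ?_⟩
  · refine hC.biUnion fun L _ => Set.countable_iUnion fun i => Set.countable_iUnion fun z => ?_
    refine Set.Subsingleton.countable ?_
    rintro t ⟨⟨p, hp⟩, h1⟩ t' ⟨-, h2⟩
    have e1 := mem_coordHyperplane.mp (h1 hp)
    have e2 := mem_coordHyperplane.mp (h2 hp)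
    linarith
  · simp only [Set.mem_iUnion, Set.mem_ofPred_eq, not_exists, not_and] at ht
    refine ⟨{L' | (L' : Set (Fin r → ℝ)).Nonempty ∧
      ∃ L ∈ C, ∃ i : Fin r, ∃ z : ℤ, L' = L ⊓ coordHyperplane i (t + δ * z)}, ?_, ?_, ?_⟩
    · refine Set.Countable.mono (s₂ := ⋃ L ∈ C, ⋃ i : Fin r, ⋃ z : ℤ,
        {L ⊓ coordHyperplane i (t + δ * z)}) ?_ ?_
      · rintro L' ⟨-, L, hL, i, z, rfl⟩
        simp only [Set.mem_iUnion]
        exact ⟨L, hL, i, z, rfl⟩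
      · exact hC.biUnion fun L _ => Set.countable_iUnion fun i => Set.countable_iUnion fun z =>
          Set.countable_singleton _
    · rintro L' ⟨hne, L, hL, i, z, rfl⟩
      have hlt : L ⊓ coordHyperplane i (t + δ * z) < L := by
        refine lt_of_le_of_ne inf_le_left fun he => ?_
        refine ht L hL i z ?_ (inf_eq_left.mp he)
        rwa [he] at hne
      have h1 := Submodule.finrank_lt_finrank_of_lt (AffineSubspace.direction_lt_of_nonempty hlt hne)
      have h2 := hdim L hL
      omega
    · rintro p ⟨hp, i, z, hz⟩
      obtain ⟨L, hL, hpL⟩ := hcov p hp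
      exact ⟨L ⊓ coordHyperplane i (t + δ * z), ⟨⟨p, hpL, hz⟩, L, hL, i, z, rfl⟩, hpL, hz⟩

/-- Finitely many grids may be put in general position with respect to a set covered by countably
many flats. -/
theorem CoveredByFlats.exists_generic_grids {r e : ℕ} {E : Set (Fin r → ℝ)}
    (h : CoveredByFlats e E) (δ : ℝ) (m : ℕ) : ∃ τ : Finset ℝ, τ.card = m ∧
      ∀ S ⊆ τ, CoveredByFlats (e - S.card) (E ∩ {p | ∀ t ∈ S, p ∈ gridHyperplanes r δ t}) := by
  induction m with
  | zero =>
    refine ⟨∅, rfl, fun S hS => ?_⟩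
    obtain rfl := Finset.subset_empty.mp hS
    simpa using h
  | succ m ih =>
    obtain ⟨τ, hτ, hcov⟩ := ih
    choose! A hA hcut using fun S (hS : S ⊆ τ) => (hcov S hS).exists_countable δ
    have hcount : ((⋃ S ∈ τ.powerset, A S) ∪ (τ : Set ℝ)).Countable :=
      (Set.Countable.biUnion (Finset.countable_toSet τ.powerset)
        fun S hS => hA S (Finset.mem_powerset.mp hS)).union τ.countable_toSet
    obtain ⟨t, ht⟩ := hcount.dense_compl ℝ |>.nonempty
    simp only [Set.mem_compl_iff, Set.mem_union, Set.mem_iUnion, not_or, not_exists,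
      Finset.mem_coe, Finset.mem_powerset] at ht
    refine ⟨insert t τ, by rw [Finset.card_insert_of_notMem ht.2, hτ], fun S hS => ?_⟩
    by_cases htS : t ∈ S
    · have hsub : S.erase t ⊆ τ := by
        rw [← Finset.subset_insert_iff]
        exact hS
      have := hcut _ hsub t (ht.1 _ hsub)
      rw [Finset.card_erase_of_mem htS] at this
      have hpos := Finset.card_pos.mpr ⟨t, htS⟩
      obtain ⟨C, hC, hdim, hc⟩ := this
      refine ⟨C, hC, fun L hL => (hdim L hL).trans_le (by omega), fun p hp => hc p ?_⟩
      exact ⟨⟨hp.1, fun u hu => hp.2 u (Finset.mem_of_mem_erase hu)⟩, hp.2 t htS⟩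
    · exact hcov S ((Finset.subset_insert_iff_of_notMem htS).mp hS)

theorem CoveredByFlats.exists_grids {r k : ℕ} {E : Set (Fin r → ℝ)}
    (h : CoveredByFlats (k + 1) E) (δ : ℝ) (m : ℕ) : ∃ t : Fin m → ℝ, ∀ p ∈ E,
      ∀ J : Finset (Fin m), (∀ j ∈ J, p ∈ gridHyperplanes r δ (t j)) → J.card ≤ k := by
  obtain ⟨τ, hτ, hcov⟩ := h.exists_generic_grids δ m
  refine ⟨fun j => τ.orderEmbOfFin hτ j, fun p hp J hJ => ?_⟩
  have hsub : J.map (τ.orderEmbOfFin hτ).toEmbedding ⊆ τ := by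
    intro t ht
    obtain ⟨j, -, rfl⟩ := Finset.mem_map.mp ht
    exact Finset.orderEmbOfFin_mem τ hτ j
  obtain ⟨C, -, hdim, hc⟩ := hcov _ hsub
  rw [Finset.card_map] at hdim
  obtain ⟨L, hL, -⟩ := hc p ⟨hp, fun t ht => by
    obtain ⟨j, hj, rfl⟩ := Finset.mem_map.mp ht
    exact hJ j hj⟩
  have := hdim L hL
  omega

theorem eventually_floor_eq {s : ℝ} (hs : ∀ z : ℤ, s ≠ z) :
    ∀ᶠ s' : ℝ in 𝓝 s, ⌊s'⌋ = ⌊s⌋ ∧ ∀ z : ℤ, s' ≠ z := by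
  have h1 : (⌊s⌋ : ℝ) < s := lt_of_le_of_ne (Int.floor_le s) (hs _).symm
  filter_upwards [Ioo_mem_nhds h1 (Int.lt_floor_add_one s)] with s' hs'
  refine ⟨Int.floor_eq_iff.mpr ⟨hs'.1.le, hs'.2⟩, ?_⟩
  rintro z rfl
  have h2 : ⌊s⌋ < z := by exact_mod_cast hs'.1
  have h3 : z < ⌊s⌋ + 1 := by exact_mod_cast hs'.2
  omega

/-- If a map from a cube to a power of a `k`-dimensional polyhedron (or of any set covered by
countably many `k`-dimensional flats) separates points at distance at least `1`, then the dimension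
of the power is at least that of the cube. -/
theorem le_mul_of_coveredByFlats {M q k r : ℕ} {E : Set (Fin r → ℝ)}
    (hE : CoveredByFlats (k + 1) E) (g : Cube M → Fin q → Fin r → ℝ) (hg : Continuous g)
    (hgE : ∀ x l, g x l ∈ E) (hsep : ∀ x y, 1 ≤ cubeDist x y → g x ≠ g y) : M ≤ q * k := by
  classical
  by_contra! hlt
  have hcd : Continuous fun p : Cube M × Cube M => cubeDist p.1 p.2 := by
    unfold cubeDist
    fun_prop
  have hK : IsCompact {p : Cube M × Cube M | 1 ≤ cubeDist p.1 p.2} :=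
    (isClosed_le continuous_const hcd).isCompact
  obtain ⟨δ, hδ, hle⟩ := hK.exists_forall_le' (f := fun p => dist (g p.1) (g p.2)) (a := 0)
    (by fun_prop) (fun p hp => dist_pos.mpr (hsep p.1 p.2 hp))
  obtain ⟨t, ht⟩ := hE.exists_grids (δ / 2) M
  have hδ2 : δ / 2 ≠ 0 := by positivity
  let u : Fin M → Cube M → Fin q → Fin r → ℝ := fun j x l i => (g x l i - t j) / (δ / 2)
  let V : Fin M → Set (Cube M) := fun j => {x | ∀ l i, ∀ z : ℤ, u j x l i ≠ z}
  let code : Fin M → Cube M → Fin q → Fin r → ℤ := fun j x l i => ⌊u j x l i⌋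
  have hloc : ∀ j, ∀ x ∈ V j, ∀ᶠ y in 𝓝 x, y ∈ V j ∧ code j y = code j x := by
    intro j x hx
    have : ∀ᶠ y in 𝓝 x, ∀ l i, ⌊u j y l i⌋ = ⌊u j x l i⌋ ∧ ∀ z : ℤ, u j y l i ≠ z := by
      refine eventually_all.mpr fun l => eventually_all.mpr fun i => ?_
      have hc : Continuous fun y => u j y l i := by
        simp only [u]
        fun_prop
      exact hc.continuousAt.eventually (eventually_floor_eq (hx l i))
    filter_upwards [this] with y hy
    exact ⟨fun l i => (hy l i).2, funext fun l => funext fun i => (hy l i).1⟩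
  have hVopen : ∀ j (S : Set (Fin q → Fin r → ℤ)), IsOpen {x | x ∈ V j ∧ code j x ∈ S} := by
    intro j S
    refine isOpen_iff_eventually.mpr fun x hx => ?_
    filter_upwards [hloc j x hx.1] with y hy
    refine ⟨hy.1, ?_⟩
    rw [hy.2]
    exact hx.2
  have hcover : ⋃ j, V j = Set.univ := by
    refine Set.eq_univ_of_forall fun x => ?_
    by_contra hx
    simp only [Set.mem_iUnion, not_exists] at hx
    have hbad : (Finset.univ : Finset (Fin M)) ⊆ Finset.univ.biUnion fun l : Fin q =>
        Finset.univ.filter fun j => g x l ∈ gridHyperplanes r (δ / 2) (t j) := by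
      intro j _
      have hj := hx j
      simp only [V, Set.mem_ofPred_eq, not_forall, not_not] at hj
      obtain ⟨l, i, z, hz⟩ := hj
      simp only [Finset.mem_biUnion, Finset.mem_univ, true_and, Finset.mem_filter]
      refine ⟨l, i, z, ?_⟩
      simp only [u] at hz
      rw [div_eq_iff hδ2] at hz
      linarith
    have h1 := (Finset.card_le_card hbad).trans (Finset.card_biUnion_le_card_mul _ _ k
      fun l _ => ht (g x l) (hgE x l) _ fun j hj => (Finset.mem_filter.mp hj).2)
    simp only [Finset.card_univ, Fintype.card_fin] at h1
    omega
  obtain ⟨K, hKuniv, hKclosed, hKV⟩ := exists_iUnion_eq_closed_subset (u := V)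
    (fun j => by simpa using hVopen j Set.univ) (fun x => Set.toFinite _) hcover
  let S : Fin M → Set (Fin q → Fin r → ℤ) := fun j => {s | ∃ a : Cube M, a j = 0 ∧ code j a = s}
  have hclosed : ∀ j (S : Set (Fin q → Fin r → ℤ)), IsClosed {x | x ∈ K j ∧ code j x ∈ S} := by
    intro j S
    have : {x | x ∈ K j ∧ code j x ∈ S} = K j ∩ {x | x ∈ V j ∧ code j x ∈ Sᶜ}ᶜ := by
      ext x
      simp only [Set.mem_ofPred_eq, Set.mem_inter_iff, Set.mem_compl_iff, not_and, not_not]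
      exact ⟨fun h => ⟨h.1, fun _ => h.2⟩, fun h => ⟨h.1, h.2 (hKV j h.1)⟩⟩
    rw [this]
    exact (hKclosed j).inter (hVopen j _).isClosed_compl
  have hface : ∀ (j : Fin M) (s : unitInterval), IsClosed {x : Cube M | x j = s} := fun j s =>
    isClosed_eq (continuous_apply j) continuous_const
  have hcode : ∀ (j : Fin M) (a x : Cube M), a j = 0 → x j = 1 → code j a ≠ code j x := by
    intro j a x ha hx he
    have hdist : 1 ≤ cubeDist a x := by
      refine le_trans ?_ (norm_le_pi_norm _ j)
      simp [ha, hx]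
    have h1 := hle (a, x) hdist
    have h2 : dist (g a) (g x) ≤ δ / 2 := by
      refine (dist_pi_le_iff (by positivity)).mpr fun l =>
        (dist_pi_le_iff (by positivity)).mpr fun i => ?_
      have h3 := Int.abs_sub_lt_one_of_floor_eq_floor (congrFun (congrFun he l) i)
      simp only [u] at h3
      rw [← sub_div, abs_div, abs_of_pos (show 0 < δ / 2 by positivity),
        div_lt_one (by positivity)] at h3
      rw [Real.dist_eq]
      rw [sub_sub_sub_cancel_right] at h3
      exact h3.le
    simp only at h1
    linarith
  obtain ⟨z, hz⟩ := exists_notMem_of_disjoint_opposite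
    (fun j => {x | x ∈ K j ∧ code j x ∈ S j} ∪ {x | x j = 0})
    (fun j => {x | x ∈ K j ∧ code j x ∈ (S j)ᶜ} ∪ {x | x j = 1})
    (fun j => (hclosed j _).union (hface j 0)) (fun j => (hclosed j _).union (hface j 1))
    (fun j => by
      rw [Set.disjoint_left]
      rintro x (⟨-, hx⟩ | hx) (⟨-, hx'⟩ | hx')
      · exact hx' hx
      · obtain ⟨a, ha, hax⟩ := hx
        exact hcode j a x ha hx' hax
      · exact hx' ⟨x, hx, rfl⟩
      · exact zero_ne_one (hx.symm.trans hx'))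
    (fun j x hx => Or.inr hx) (fun j x hx => Or.inr hx)
  obtain ⟨j, hj⟩ := Set.mem_iUnion.mp (hKuniv.ge (Set.mem_univ z))
  by_cases hzS : code j z ∈ S j
  · exact (hz j).1 (Or.inl ⟨hj, hzS⟩)
  · exact (hz j).2 (Or.inl ⟨hj, hzS⟩)

theorem setEDiam_lt_ofReal {X : Type*} {ρ : X → X → ℝ} {E : Set X} {η ε : ℝ} (hη : η < ε)
    (hε : 0 < ε) (h : ∀ x ∈ E, ∀ y ∈ E, ρ x y ≤ η) : setEDiam ρ E < ENNReal.ofReal ε := by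
  refine lt_of_le_of_lt ?_ ((ENNReal.ofReal_lt_ofReal_iff hε).mpr hη)
  exact iSup₂_le fun x hx => iSup₂_le fun y hy => ENNReal.ofReal_le_ofReal (h x hx y hy)

theorem lt_of_setEDiam_lt {X : Type*} {ρ : X → X → ℝ} {E : Set X} {ε : ℝ}
    (h : setEDiam ρ E < ENNReal.ofReal ε) {x y : X} (hx : x ∈ E) (hy : y ∈ E) : ρ x y < ε := by
  refine (ENNReal.ofReal_lt_ofReal_iff'.mp (lt_of_le_of_lt ?_ h)).1
  exact le_trans (le_iSup₂ (f := fun y _ => ENNReal.ofReal (ρ x y)) y hy)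
    (le_iSup₂ (f := fun x _ => ⨆ y ∈ E, ENNReal.ofReal (ρ x y)) x hx)

/-- The complex consisting of all faces of the standard simplex in `ℝ^m`. -/
noncomputable def stdSimplexComplex (m : ℕ) : Geometry.SimplicialComplex ℝ (Fin m → ℝ) :=
  Geometry.SimplicialComplex.ofAffineIndependent
    { faces := {s | s.Nonempty ∧ s ⊆ Finset.univ.image fun i : Fin m => Pi.single i (1 : ℝ)}
      isRelLowerSet_faces := fun _ hs => ⟨hs.1, fun _ ht htn => ⟨htn, ht.trans hs.2⟩⟩ }
    (by
      refine AffineIndependent.mono (t := Set.range fun i : Fin m => Pi.single i (1 : ℝ)) ?_ ?_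
      · refine AffineIndependent.range (p := fun i : Fin m => Pi.single i (1 : ℝ)) ?_
        exact (Pi.linearIndependent_single_one (Fin m) ℝ).affineIndependent
      · refine Set.iUnion₂_subset fun s hs p hp => ?_
        simpa using hs.2 hp)

theorem stdSimplex_subset_space (m : ℕ) : stdSimplex ℝ (Fin m) ⊆ (stdSimplexComplex m).space := by
  intro p hp
  rcases isEmpty_or_nonempty (Fin m) with hm | hm
  · simpa using hp.2
  · refine Geometry.SimplicialComplex.mem_space_iff.mpr
      ⟨Finset.univ.image fun i : Fin m => Pi.single i (1 : ℝ),
        ⟨Finset.univ_nonempty.image _, subset_rfl⟩, ?_⟩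
    rw [Finset.coe_image, Finset.coe_univ, Set.image_univ, convexHull_rangle_single_eq_stdSimplex]
    exact hp

/-- The infimum defining `widim` is attained as soon as all points have small neighbourhoods. -/
theorem widim_spec {X : Type*} [TopologicalSpace X] [CompactSpace X] [T2Space X]
    {ρ : X → X → ℝ} {η ε : ℝ} (hη : η < ε) (hε : 0 < ε)
    (h : ∀ x, ∃ U, IsOpen U ∧ x ∈ U ∧ ∀ y ∈ U, ∀ z ∈ U, ρ y z ≤ η) :
    ∃ (m : ℕ) (K : Geometry.SimplicialComplex ℝ (Fin m → ℝ)),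
      K.faces.Finite ∧ (∀ s ∈ K.faces, s.card ≤ widim X ρ ε + 1) ∧
      ∃ f : X → K.space, Continuous f ∧
        ∀ p : K.space, setEDiam ρ (f ⁻¹' {p}) < ENNReal.ofReal ε := by
  refine Nat.sInf_mem (s := {k : ℕ | ∃ (m : ℕ) (K : Geometry.SimplicialComplex ℝ (Fin m → ℝ)),
    K.faces.Finite ∧ (∀ s ∈ K.faces, s.card ≤ k + 1) ∧
    ∃ f : X → K.space, Continuous f ∧
      ∀ p : K.space, setEDiam ρ (f ⁻¹' {p}) < ENNReal.ofReal ε}) ?_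
  choose U hU hxU hUρ using h
  obtain ⟨t, ht⟩ := isCompact_univ.elim_finite_subcover U hU
    fun x _ => Set.mem_iUnion.mpr ⟨x, hxU x⟩
  let c : Fin t.card → X := fun i => t.equivFin.symm i
  have hc : Set.univ ⊆ ⋃ i, U (c i) := by
    intro x hx
    obtain ⟨y, hy, hxy⟩ := Set.mem_iUnion₂.mp (ht hx)
    exact Set.mem_iUnion.mpr ⟨t.equivFin ⟨y, hy⟩, by simpa [c] using hxy⟩
  obtain ⟨φ, hφ⟩ := PartitionOfUnity.exists_isSubordinate isClosed_univ (fun i => U (c i))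
    (fun i => hU _) hc
  have hsum : ∀ x, ∑ i, φ i x = 1 := fun x => by
    rw [← finsum_eq_sum_of_fintype]
    exact φ.sum_eq_one (Set.mem_univ x)
  refine ⟨t.card, t.card, stdSimplexComplex t.card, ?_, ?_,
    fun x => ⟨fun i => φ i x, stdSimplex_subset_space _ ⟨fun i => φ.nonneg i x, hsum x⟩⟩, ?_, ?_⟩
  · exact (Finset.finite_toSet (Finset.powerset _)).subset fun s hs =>
      Finset.mem_coe.mpr (Finset.mem_powerset.mpr hs.2)
  · intro s hs
    have := (Finset.card_le_card hs.2).trans Finset.card_image_le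
    rw [Finset.card_univ, Fintype.card_fin] at this
    omega
  · exact Continuous.subtype_mk (continuous_pi fun i => (φ i).continuous) _
  · rintro p
    refine setEDiam_lt_ofReal hη hε fun x hx y hy => ?_
    have hxy : ∀ i, φ i x = φ i y := fun i =>
      congrFun (congrArg Subtype.val (hx.trans hy.symm)) i
    obtain ⟨i, -, hi⟩ := Finset.exists_ne_zero_of_sum_ne_zero ((hsum x).trans_ne one_ne_zero)
    exact hUρ (c i) x (hφ i (subset_tsupport _ hi)) y
      (hφ i (subset_tsupport _ (by rwa [Function.mem_support, ← hxy i])))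

theorem coveredByFlats_space {m k : ℕ} {K : Geometry.SimplicialComplex ℝ (Fin m → ℝ)}
    (hK : K.faces.Finite) (hk : ∀ s ∈ K.faces, s.card ≤ k + 1) :
    CoveredByFlats (k + 1) K.space := by
  classical
  refine ⟨(fun s : Finset (Fin m → ℝ) => affineSpan ℝ (s : Set (Fin m → ℝ))) '' K.faces,
    (hK.image _).countable, ?_, fun p hp => ?_⟩
  · rintro _ ⟨s, hs, rfl⟩
    have hpos := (K.nonempty_of_mem_faces hs).card_pos
    have := finrank_vectorSpan_image_finset_le ℝ (id : (Fin m → ℝ) → Fin m → ℝ) s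
      (n := s.card - 1) (by omega)
    rw [Finset.image_id] at this
    have h2 := hk s hs
    rw [direction_affineSpan]
    omega
  · obtain ⟨s, hs, hps⟩ := Geometry.SimplicialComplex.mem_space_iff.mp hp
    exact ⟨_, ⟨s, hs, rfl⟩, convexHull_subset_affineSpan _ hps⟩

theorem finite_dynDist_set {X : Type*} (T : X → X) (d : X → X → ℝ) (N : ℕ) (x y : X) :
    {r : ℝ | ∃ n, n < N ∧ r = d (T^[n] x) (T^[n] y)}.Finite := by
  refine ((Set.finite_lt_nat N).image fun n => d (T^[n] x) (T^[n] y)).subset ?_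
  rintro _ ⟨n, hn, rfl⟩
  exact ⟨n, hn, rfl⟩

theorem le_dynDist {X : Type*} (T : X → X) (d : X → X → ℝ) {N n : ℕ} (hn : n < N) (x y : X) :
    d (T^[n] x) (T^[n] y) ≤ dynDist T d N x y :=
  le_csSup (finite_dynDist_set T d N x y).bddAbove ⟨n, hn, rfl⟩

theorem exists_le_of_le_dynDist {X : Type*} {T : X → X} {d : X → X → ℝ} {N : ℕ} {x y : X} {c : ℝ}
    (hc : 0 < c) (h : c ≤ dynDist T d N x y) : ∃ n < N, c ≤ d (T^[n] x) (T^[n] y) := by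
  by_cases hne : {r : ℝ | ∃ n, n < N ∧ r = d (T^[n] x) (T^[n] y)}.Nonempty
  · obtain ⟨n, hn, he⟩ := hne.csSup_mem (finite_dynDist_set T d N x y)
    exact ⟨n, hn, h.trans he.le⟩
  · rw [dynDist, Set.not_nonempty_iff_eq_empty.mp hne, Real.sSup_empty] at h
    exact absurd h hc.not_ge

theorem exists_small_nhd_dynDist {X : Type*} [PseudoMetricSpace X] {T : X → X} (hT : Continuous T)
    (N : ℕ) {ε : ℝ} (hε : 0 < ε) (x : X) :
    ∃ U, IsOpen U ∧ x ∈ U ∧ ∀ y ∈ U, ∀ z ∈ U, dynDist T dist N y z ≤ ε := by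
  refine ⟨⋂ n ∈ Finset.range N, {y | dist (T^[n] y) (T^[n] x) < ε / 2},
    isOpen_biInter_finset fun n _ => isOpen_lt ((hT.iterate n).dist continuous_const)
      continuous_const, ?_, fun y hy z hz => ?_⟩
  · simp [hε]
  · simp only [Set.mem_iInter, Finset.mem_range, Set.mem_ofPred_eq] at hy hz
    refine Real.sSup_le ?_ hε.le
    rintro _ ⟨n, hn, rfl⟩
    have := dist_triangle_right (T^[n] y) (T^[n] z) (T^[n] x)
    linarith [hy n hn, hz n hn]

/-- A continuous map from a cube expanding the `ℓ^∞`-distance into `d_L` bounds the widths of `X`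
for all the metrics `d_N` from below. -/
theorem le_mul_widim_dynDist {X : Type*} [MetricSpace X] [CompactSpace X] {T : X → X}
    (hT : Continuous T) {M L N : ℕ} (hN : 0 < N) {ε : ℝ} (hε : 0 < ε) (hε1 : ε ≤ 1)
    (ψ : Cube M → X) (hψ : Continuous ψ)
    (hexp : ∀ x y, cubeDist x y ≤ dynDist T dist L (ψ x) (ψ y)) :
    M ≤ (L / N + 1) * widim X (dynDist T dist N) ε := by
  obtain ⟨m, K, hfin, hcard, f, hf, hfib⟩ := widim_spec (half_lt_self hε) hε
    (exists_small_nhd_dynDist hT N (half_pos hε))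
  refine le_mul_of_coveredByFlats (coveredByFlats_space hfin hcard)
    (fun x (l : Fin (L / N + 1)) => (f (T^[l * N] (ψ x)) : Fin m → ℝ)) ?_
    (fun x l => (f _).2) fun x y hxy he => ?_
  · exact continuous_pi fun l =>
      continuous_subtype_val.comp (hf.comp ((hT.iterate _).comp hψ))
  · obtain ⟨n, hn, hle⟩ := exists_le_of_le_dynDist one_pos (hxy.trans (hexp x y))
    have hl : n / N < L / N + 1 := Nat.lt_succ_of_le (Nat.div_le_div_right hn.le)
    have h1 := Subtype.ext (congrFun he ⟨n / N, hl⟩)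
    have h2 := lt_of_setEDiam_lt (hfib (f (T^[n / N * N] (ψ y)))) h1 rfl
    have h3 := le_dynDist T dist (Nat.mod_lt n hN) (T^[n / N * N] (ψ x)) (T^[n / N * N] (ψ y))
    rw [← Function.iterate_add_apply, ← Function.iterate_add_apply,
      show n % N + n / N * N = n by rw [mul_comm]; exact Nat.mod_add_div n N] at h3
    linarith

/-- main technical theorem, conclusion (1): if there are `N_n → ∞`,
`M_n/N_n → s` and continuous maps `ψ_n : [0,1]^{M_n} → X` expanding the `ℓ^∞`-distance
into `d_{N_n}`, then `mdim(X, T) ≥ s`. -/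
theorem stmt_15 (s : ℝ) (hs : 0 ≤ s) (X : Type) [MetricSpace X] [CompactSpace X]
    (T : X ≃ₜ X) (N M : ℕ → ℕ)
    (ψ : ∀ n, Cube (M n) → X) (hψcont : ∀ n, Continuous (ψ n))
    (hN : Filter.Tendsto N Filter.atTop Filter.atTop)
    (hMN : Filter.Tendsto (fun n => (M n : ℝ) / (N n : ℝ)) Filter.atTop (𝓝 s))
    (hexp : ∀ (n : ℕ) (x y : Cube (M n)),
      cubeDist x y ≤ dynDist (⇑T) dist (N n) (ψ n x) (ψ n y)) :
    (s : EReal) ≤ mdim X (⇑T) dist := by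
  refine le_limsup_of_frequently_le (Eventually.frequently ?_)
  filter_upwards [Ioc_mem_nhdsGT (zero_lt_one (α := ℝ))] with ε hε
  refine le_liminf_of_le (by isBoundedDefault) ?_
  filter_upwards [eventually_gt_atTop 0] with L hL
  rw [EReal.coe_le_coe_iff]
  have hL' : (0 : ℝ) < L := by exact_mod_cast hL
  rw [le_div_iff₀ hL']
  set k := widim X (dynDist T dist L) ε
  have hinv : Tendsto (fun n => ((N n : ℕ) : ℝ)⁻¹) atTop (𝓝 0) :=
    tendsto_inv_atTop_zero.comp (tendsto_natCast_atTop_atTop.comp hN)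
  have hlim : Tendsto (fun n => (1 + (L : ℝ) * (N n : ℝ)⁻¹) * k) atTop (𝓝 k) := by
    simpa using ((hinv.const_mul (L : ℝ)).const_add 1).mul_const (k : ℝ)
  refine le_of_tendsto_of_tendsto (hMN.mul_const (L : ℝ)) hlim ?_
  filter_upwards [hN.eventually_gt_atTop 0] with n hn
  have hn' : (0 : ℝ) < N n := by exact_mod_cast hn
  have h1 : (M n : ℝ) ≤ (((N n / L : ℕ) : ℝ) + 1) * k := by
    exact_mod_cast le_mul_widim_dynDist T.continuous hL hε.1 hε.2 (ψ n) (hψcont n) (hexp n)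
  have h2 : ((N n / L : ℕ) : ℝ) * L ≤ N n := by exact_mod_cast Nat.div_mul_le_self (N n) L
  have h3 : (M n : ℝ) * L ≤ (N n + L) * k :=
    calc (M n : ℝ) * L ≤ (((N n / L : ℕ) : ℝ) + 1) * k * L := by gcongr
      _ = (((N n / L : ℕ) : ℝ) * L + L) * k := by ring
      _ ≤ (N n + L) * k := by gcongr
  calc (M n : ℝ) / N n * L = M n * L / N n := by ring
    _ ≤ (N n + L) * k / N n := by gcongr
    _ = (1 + (L : ℝ) * (N n : ℝ)⁻¹) * k := by field_simp
end
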